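/- arXiv:1910.05928 — 5 statements merged into one kernel-verified Lean document; each statement's English description precedes it below -/
import Mathlib

section
/- The identity map on ℤIrr(B) is a perfect isometry. Concretely: (sep) if exactly one of g,h ∈ G is p-regular, then Σ_{χ∈Irr(B)} χ(g)χ̄(h⁻¹) = 0; and (int) for all g,h ∈ G the numbers (Σ_{χ∈Irr(B)} χ(g)χ̄(h⁻¹))/|C_G(g)|_p and (Σ_{χ∈Irr(B)} χ(g)χ̄(h⁻¹))/|C_G(h)|_p are algebraic integers. -/
open scoped BigOperators
open Finset

noncomputable section

/-- `χ : G → ℂ` is an irreducible complex character of the finite group `G`. -/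
def IsIrrChar (G : Type) [Group G] [Fintype G] (χ : G → ℂ) : Prop :=
  ∃ V : FDRep ℂ G, CategoryTheory.Simple V ∧ χ = V.character

/-- An element is `p`-regular if `p` does not divide its order. -/
def pRegular (p : ℕ) {G : Type} [Monoid G] (g : G) : Prop :=
  ¬ p ∣ orderOf g

/-- The `p`-part of a natural number. -/
def pPart (p n : ℕ) : ℕ := p ^ (n.factorization p)

/-- The `p`-part of the order of the centralizer of `g`. -/
def centOrderP (p : ℕ) {G : Type} [Group G] (g : G) : ℕ :=
  pPart p (Nat.card (Subgroup.centralizer ({g} : Set G)))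

/-- The usual inner product of class functions on a finite group. -/
def innerChar (G : Type) [Group G] [Fintype G] (χ ψ : G → ℂ) : ℂ :=
  (Fintype.card G : ℂ)⁻¹ * ∑ g : G, χ g * ψ g⁻¹

/-- The group `ℤIrr(B)` of generalized characters of a block `B`, realized as the
`ℤ`-span of the characters in `B` inside the functions `G → ℂ`. -/
def ZIrr {G : Type} [Group G] [Fintype G] (B : Finset (G → ℂ)) : Submodule ℤ (G → ℂ) :=
  Submodule.span ℤ (B : Set (G → ℂ))

/-- A character `χ ∈ B` viewed as an element of `ℤIrr(B)`. -/
def elt {G : Type} [Group G] [Fintype G] {B : Finset (G → ℂ)} (χ : G → ℂ) (h : χ ∈ B) :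
    ZIrr B :=
  ⟨χ, Submodule.subset_span (Finset.mem_coe.mpr h)⟩

/-- Broué's function `μ_I(g,h) = ∑_{χ ∈ Irr(B)} χ(g)·I(χ)(h)`. -/
def muI {G H : Type} [Group G] [Fintype G] [Group H] [Fintype H]
    {B : Finset (G → ℂ)} {B' : Finset (H → ℂ)}
    (I : ZIrr B →ₗ[ℤ] ZIrr B') (g : G) (h : H) : ℂ :=
  ∑ χ ∈ B.attach, χ.1 g * ((I (elt χ.1 χ.2) : ZIrr B') : H → ℂ) h

/-- Broué's notion of a perfect isometry: an inner-product preserving `ℤ`-linear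
bijection `ℤIrr(B) → ℤIrr(B')` satisfying the separation condition (sep) and the
integrality condition (int). -/
def IsPerfIso (p : ℕ) {G H : Type} [Group G] [Fintype G] [Group H] [Fintype H]
    (B : Finset (G → ℂ)) (B' : Finset (H → ℂ)) (I : ZIrr B ≃ₗ[ℤ] ZIrr B') : Prop :=
  (∀ x y : ZIrr B,
      innerChar H (I x : H → ℂ) (I y : H → ℂ) = innerChar G (x : G → ℂ) (y : G → ℂ)) ∧
  (∀ (g : G) (h : H), Xor' (pRegular p g) (pRegular p h) → muI I.toLinearMap g h = 0) ∧
  (∀ (g : G) (h : H), IsIntegral ℤ (muI I.toLinearMap g h / (centOrderP p g : ℂ)) ∧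
      IsIntegral ℤ (muI I.toLinearMap g h / (centOrderP p h : ℂ)))

/-- By Osima's theorem, `B` is a union of `p`-blocks iff it consists of irreducible
characters and satisfies block orthogonality between `p`-regular and `p`-singular
columns. -/
def IsBlockUnion (p : ℕ) (G : Type) [Group G] [Fintype G] (B : Finset (G → ℂ)) : Prop :=
  (∀ χ ∈ B, IsIrrChar G χ) ∧
  ∀ g h : G, pRegular p g → ¬ pRegular p h → ∑ χ ∈ B, χ g * χ h = 0

/-- A `p`-block of `G`: a minimal nonempty union of blocks. -/
def IsBlock (p : ℕ) (G : Type) [Group G] [Fintype G] (B : Finset (G → ℂ)) : Prop :=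
  IsBlockUnion p G B ∧ B.Nonempty ∧
    ∀ C ⊆ B, IsBlockUnion p G C → C = ∅ ∨ C = B

section helpers

open Module CategoryTheory

lemma intCast_isIntegral' (a : ℤ) : IsIntegral ℤ (a : ℂ) := by
  have := isIntegral_algebraMap (R := ℤ) (A := ℂ) (x := a)
  simpa using this

lemma natCast_isIntegral' (a : ℕ) : IsIntegral ℤ (a : ℂ) := by
  simpa using intCast_isIntegral' (a : ℤ)

lemma trace_pow_formula {V : Type*} [AddCommGroup V] [Module ℂ V] [FiniteDimensional ℂ V]
    (f : V →ₗ[ℂ] V) (n : ℕ) (hn : n ≠ 0) (hf : f ^ n = 1) :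
    ∃ (s : Finset ℂ) (d : ℂ → ℕ), (∀ μ ∈ s, μ ^ n = 1) ∧
      ∀ k : ℕ, LinearMap.trace ℂ V (f ^ k) = ∑ μ ∈ s, μ ^ k * d μ := by
  classical
  have hss : Module.End.IsSemisimple f := by
    apply Module.End.isSemisimple_of_squarefree_aeval_eq_zero (p := Polynomial.X ^ n - 1)
    · exact (Polynomial.separable_X_pow_sub_C (1:ℂ) (by exact_mod_cast hn) one_ne_zero).squarefree
    · simp [hf]
  have htop : ⨆ μ : ℂ, Module.End.eigenspace f μ = ⊤ := by
    have := Module.End.iSup_maxGenEigenspace_eq_top f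
    simpa only [hss.isFinitelySemisimple.maxGenEigenspace_eq_eigenspace] using this
  have hint : DirectSum.IsInternal (fun μ : ℂ => Module.End.eigenspace f μ) :=
    DirectSum.isInternal_submodule_of_iSupIndep_of_iSup_eq_top
      (Module.End.eigenspaces_iSupIndep f) htop
  have hfin : {μ : ℂ | Module.End.eigenspace f μ ≠ ⊥}.Finite :=
    Module.End.finite_hasEigenvalue f
  have hpow : ∀ (k : ℕ) (μ : ℂ) (x : V), x ∈ Module.End.eigenspace f μ →
      (f ^ k) x = μ ^ k • x := by
    intro k μ x hx
    rw [Module.End.mem_eigenspace_iff] at hx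
    induction k with
    | zero => simp
    | succ k ih => rw [pow_succ', Module.End.mul_apply, ih, map_smul, hx, smul_smul, pow_succ]
  refine ⟨hfin.toFinset, fun μ => finrank ℂ (Module.End.eigenspace f μ), ?_, ?_⟩
  · intro μ hμ
    simp only [Set.Finite.mem_toFinset, Set.mem_ofPred_eq] at hμ
    obtain ⟨x, hx, hx0⟩ := Submodule.exists_mem_ne_zero_of_ne_bot hμ
    have h := hpow n μ x hx
    rw [hf, Module.End.one_apply] at h
    by_contra hne
    have : (μ ^ n - 1) • x = 0 := by rw [sub_smul, ← h, one_smul, sub_self]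
    rcases smul_eq_zero.mp this with h | h
    · exact hne (sub_eq_zero.mp h)
    · exact hx0 h
  · intro k
    have hm : ∀ μ : ℂ, Set.MapsTo (f ^ k) (Module.End.eigenspace f μ) (Module.End.eigenspace f μ) := by
      intro μ x hx
      rw [hpow k μ x hx]
      exact Submodule.smul_mem _ _ hx
    rw [LinearMap.trace_eq_sum_trace_restrict' hint hfin hm]
    apply Finset.sum_congr rfl
    intro μ _
    have : (f ^ k).restrict (hm μ) = μ ^ k • LinearMap.id := by
      refine LinearMap.ext fun x => Subtype.ext ?_
      exact hpow k μ x x.2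
    rw [this, map_smul, LinearMap.trace_id, smul_eq_mul]

lemma char_integral {G : Type} [Group G] [Fintype G] (V : FDRep ℂ G) (g : G) :
    IsIntegral ℤ (V.character g) := by
  obtain ⟨s, d, h1, h2⟩ := trace_pow_formula (V.ρ g) (orderOf g) (orderOf_pos g).ne'
    (by rw [← map_pow, pow_orderOf_eq_one, map_one])
  have := h2 1
  rw [pow_one] at this
  rw [FDRep.character, this]
  refine IsIntegral.sum _ fun μ hμ => ?_
  have hd : IsIntegral ℤ ((d μ : ℕ) : ℂ) := by
    have := isIntegral_algebraMap (R := ℤ) (A := ℂ) (x := (d μ : ℤ))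
    simpa using this
  refine IsIntegral.mul ?_ hd
  rw [pow_one]
  exact IsIntegral.of_pow (orderOf_pos g) (by rw [h1 μ hμ]; exact isIntegral_one)

lemma char_conj_inv {G : Type} [Group G] [Fintype G] (V : FDRep ℂ G) (g : G) :
    (starRingEnd ℂ) (V.character g⁻¹) = V.character g := by
  have hpos := orderOf_pos g
  obtain ⟨s, d, h1, h2⟩ := trace_pow_formula (V.ρ g) (orderOf g) hpos.ne'
    (by rw [← map_pow, pow_orderOf_eq_one, map_one])
  have e1 := h2 1
  have e2 := h2 (orderOf g - 1)
  have hg : g ^ (orderOf g - 1) = g⁻¹ := by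
    rw [eq_inv_iff_mul_eq_one, ← pow_succ, Nat.sub_add_cancel hpos, pow_orderOf_eq_one]
  rw [← map_pow, hg] at e2
  rw [pow_one] at e1
  rw [FDRep.character, FDRep.character, e1, e2, map_sum]
  refine Finset.sum_congr rfl fun μ hμ => ?_
  have hμ1 := h1 μ hμ
  have hnorm : ‖μ‖ = 1 := Complex.norm_eq_one_of_pow_eq_one hμ1 hpos.ne'
  have : μ ^ (orderOf g - 1) = μ⁻¹ := by
    apply eq_inv_of_mul_eq_one_left
    rw [← pow_succ, Nat.sub_add_cancel hpos, hμ1]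
  rw [map_mul, this, Complex.inv_eq_conj hnorm, Complex.conj_conj, pow_one]
  simp

lemma char_schur {G : Type} [Group G] [Fintype G] (V : FDRep ℂ G) [Simple V] (g h : G) :
    (Fintype.card G : ℂ) * (V.character g * V.character h) =
      ∑ x : G, V.character 1 * V.character (x * g * x⁻¹ * h) := by
  classical
  let T : V →ₗ[ℂ] V := ∑ x : G, V.ρ (x * g * x⁻¹)
  have hT : ∀ y : G, T * V.ρ y = V.ρ y * T := by
    intro y
    simp only [T, Finset.sum_mul, Finset.mul_sum, ← map_mul]
    refine Fintype.sum_equiv (Equiv.mulLeft y⁻¹) _ _ fun x => ?_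
    congr 1
    simp [mul_assoc]
  let F : V ⟶ V := ⟨InducedCategory.homMk (ModuleCat.ofHom T), fun y => by
    ext1
    exact hT y⟩
  obtain ⟨c, hc⟩ := endomorphism_simple_eq_smul_id ℂ F
  have hTc : T = c • LinearMap.id := by
    have := congrArg (fun f : V ⟶ V => f.hom.hom.hom) hc
    exact this.symm
  have t1 : (Fintype.card G : ℂ) * V.character g = c * V.character 1 := by
    have := congrArg (LinearMap.trace ℂ V) hTc
    simp only [T, map_sum, map_smul, smul_eq_mul] at this
    rw [FDRep.char_one, ← LinearMap.trace_id ℂ V, ← this]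
    have h3 : ∀ x : G, LinearMap.trace ℂ V (V.ρ (x * g * x⁻¹)) = V.character g :=
      fun x => FDRep.char_conj V g x
    rw [Finset.sum_congr rfl fun x _ => h3 x]
    simp
  have t2 : ∑ x : G, V.character (x * g * x⁻¹ * h) = c * V.character h := by
    have := congrArg (fun f => LinearMap.trace ℂ V (f * V.ρ h)) hTc
    simp only [T, Finset.sum_mul, map_sum, ← map_mul] at this
    rw [show (∑ x : G, V.character (x * g * x⁻¹ * h)) = _ from this]
    change LinearMap.trace ℂ V (c • V.ρ h) = _
    rw [map_smul]; rfl
  rw [← Finset.mul_sum, t2, ← mul_assoc, t1]; ring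

lemma char_sum_subgroup {G : Type} [Group G] [Fintype G] (V : FDRep ℂ G) (P : Subgroup G)
    [Fintype P] : ∃ n : ℕ, ∑ x : P, V.character x = (Nat.card P : ℂ) * n := by
  have h0 : (Nat.card P : ℂ) ≠ 0 := by exact_mod_cast Nat.card_pos.ne'
  let _ : Invertible (Nat.card P : ℂ) := invertibleOfNonzero h0
  have := Representation.card_inv_mul_sum_char_eq_finrank
    ((V.ρ.comp P.subtype : P →* _) : Representation ℂ P V)
  refine ⟨finrank ℂ (Representation.invariants
    ((V.ρ.comp P.subtype : P →* _) : Representation ℂ P V)), ?_⟩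
  · rw [← this, ← mul_assoc, mul_inv_cancel₀ h0, one_mul]; rfl

lemma sum_coset {G : Type} [Group G] [Fintype G] (C : Subgroup G) (f : G → ℂ)
    (hf : ∀ x, ∀ c ∈ C, f (x * c) = f x) (hi : ∀ x, IsIntegral ℤ (f x)) :
    ∃ z : ℂ, IsIntegral ℤ z ∧ ∑ x : G, f x = (Nat.card C : ℂ) * z := by
  classical
  refine ⟨∑ q : G ⧸ C, f q.out, IsIntegral.sum _ fun q _ => hi _, ?_⟩
  rw [← Finset.sum_fiberwise (s := Finset.univ) (g := fun x : G => (x : G ⧸ C)), Finset.mul_sum]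
  refine Finset.sum_congr rfl fun q _ => ?_
  have hq : ∀ x ∈ Finset.univ.filter (fun x : G => (x : G ⧸ C) = q), f x = f q.out := by
    intro x hx
    have hx : (x : G ⧸ C) = q := by simpa using hx
    have : ((q.out : G) : G ⧸ C) = (x : G ⧸ C) := by rw [hx]; exact Quotient.out_eq' q
    have h2 := QuotientGroup.eq.mp this
    have h3 := hf q.out _ h2
    rw [← h3]; congr 1; group
  rw [Finset.sum_congr rfl hq, Finset.sum_const, nsmul_eq_mul]
  congr 2
  have e : {x : G // (x : G ⧸ C) = q} ≃ C := by
    refine ⟨fun x => ⟨q.out⁻¹ * x.1, QuotientGroup.eq.mp ?_⟩,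
      fun c => ⟨q.out * c, ?_⟩, fun x => by simp, fun c => by simp⟩
    · rw [x.2]; exact Quotient.out_eq' q
    · rw [QuotientGroup.mk_mul_of_mem _ c.2]; exact Quotient.out_eq' q
  rw [← Nat.card_congr e, Nat.card_eq_fintype_card, Fintype.card_subtype]

lemma block_T {p : ℕ} [Fact p.Prime] {G : Type} [Group G] [Fintype G]
    {B : Finset (G → ℂ)} (hB : IsBlockUnion p G B) (y : G) :
    IsIntegral ℤ ((∑ χ ∈ B, χ 1 * χ y) / (pPart p (Nat.card G) : ℂ)) := by
  classical
  have hp : p.Prime := Fact.out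
  have hreg1 : pRegular p (1 : G) := by
    unfold pRegular; rw [orderOf_one]; exact hp.one_lt.ne' ∘ Nat.dvd_one.mp
  by_cases hy : pRegular p y
  swap
  · rw [hB.2 1 y hreg1 hy, zero_div]; exact isIntegral_zero
  let P : Sylow p G := default
  have hcard : Nat.card P = pPart p (Nat.card G) := P.card_eq_multiplicity
  have hP0 : (Nat.card P : ℂ) ≠ 0 := by exact_mod_cast Nat.card_pos.ne'
  have hsing : ∀ x : P, x ≠ 1 → ∑ χ ∈ B, χ x * χ y = 0 := by
    intro x hx
    have : ¬ pRegular p (x : G) := by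
      obtain ⟨k, hk⟩ := (IsPGroup.iff_orderOf.mp P.isPGroup') x
      unfold pRegular
      rw [not_not, Subgroup.orderOf_coe, hk]
      refine dvd_pow_self p ?_
      rintro rfl
      rw [pow_zero, orderOf_eq_one_iff] at hk
      exact hx hk
    rw [← hB.2 y x hy this]
    exact Finset.sum_congr rfl fun χ _ => mul_comm _ _
  have key : ∑ χ ∈ B, χ 1 * χ y = ∑ χ ∈ B, (∑ x : P, χ x) * χ y := by
    simp only [Finset.sum_mul]
    rw [Finset.sum_comm]
    symm
    exact Fintype.sum_eq_single (1 : P) fun x hx => hsing x hx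
  rw [← hcard, key, Finset.sum_div]
  refine IsIntegral.sum _ fun χ hχ => ?_
  obtain ⟨V, hV, rfl⟩ := hB.1 χ hχ
  obtain ⟨n, hn⟩ := char_sum_subgroup V (P : Subgroup G)
  have : (∑ x : P, V.character x) * V.character y / (Nat.card P : ℂ) = n * V.character y := by
    rw [show (∑ x : P, V.character x) = _ from hn]
    change (Nat.card P : ℂ) * n * V.character y / (Nat.card P : ℂ) = n * V.character y
    field_simp
  rw [this]
  exact (natCast_isIntegral' n).mul (char_integral V y)

lemma block_int {p : ℕ} [Fact p.Prime] {G : Type} [Group G] [Fintype G]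
    {B : Finset (G → ℂ)} (hB : IsBlockUnion p G B) (g h : G) :
    IsIntegral ℤ ((∑ χ ∈ B, χ g * χ h) / (centOrderP p g : ℂ)) := by
  classical
  have hp : p.Prime := Fact.out
  let C := Subgroup.centralizer ({g} : Set G)
  let w : G → ℂ := fun y => (∑ χ ∈ B, χ 1 * χ y) / (pPart p (Nat.card G) : ℂ)
  have hw : ∀ y, IsIntegral ℤ (w y) := block_T hB
  have hG0 : Nat.card G ≠ 0 := Nat.card_pos.ne'
  have hC0 : Nat.card C ≠ 0 := Nat.card_pos.ne'
  have hP0 : (pPart p (Nat.card G) : ℂ) ≠ 0 := by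
    unfold pPart; exact_mod_cast pow_ne_zero _ hp.ne_zero
  have hQ0 : (centOrderP p g : ℂ) ≠ 0 := by
    unfold centOrderP pPart; exact_mod_cast pow_ne_zero _ hp.ne_zero
  obtain ⟨m, hm, hcop⟩ : ∃ m, pPart p (Nat.card G) * m = Nat.card G ∧ Nat.Coprime p m :=
    ⟨_, Nat.ordProj_mul_ordCompl_eq_self _ p, Nat.coprime_ordCompl hp hG0⟩
  obtain ⟨c, hc⟩ : ∃ c, centOrderP p g * c = Nat.card C :=
    ⟨_, Nat.ordProj_mul_ordCompl_eq_self _ p⟩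
  obtain ⟨z, hz, hsum⟩ := sum_coset C (fun x => w (x * g * x⁻¹ * h)) (by
    intro x c hc
    have : c * g = g * c := (Subgroup.mem_centralizer_singleton_iff.mp hc)
    have h2 : x * c * g * (x * c)⁻¹ * h = x * g * x⁻¹ * h := by
      rw [mul_assoc x c g, this]; group
    simp only [h2]) (fun x => hw _)
  have hS : (Nat.card G : ℂ) * ∑ χ ∈ B, χ g * χ h =
      pPart p (Nat.card G) * ∑ x : G, w (x * g * x⁻¹ * h) := by
    simp only [w, ← Finset.sum_div]
    rw [mul_div_cancel₀ _ hP0, Finset.sum_comm, Finset.mul_sum]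
    refine Finset.sum_congr rfl fun χ hχ => ?_
    obtain ⟨V, hV, rfl⟩ := hB.1 χ hχ
    rw [Nat.card_eq_fintype_card]
    exact char_schur V g h
  set S := ∑ χ ∈ B, χ g * χ h with hSdef
  have hSint : IsIntegral ℤ S := by
    refine IsIntegral.sum _ fun χ hχ => ?_
    obtain ⟨V, hV, rfl⟩ := hB.1 χ hχ
    exact (char_integral V g).mul (char_integral V h)
  have hmS : (m : ℂ) * (S / centOrderP p g) = c * z := by
    have hm' : (pPart p (Nat.card G) : ℂ) * m = Nat.card G := by exact_mod_cast hm
    have hc' : (centOrderP p g : ℂ) * c = Nat.card C := by exact_mod_cast hc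
    rw [hsum, ← hc', ← hm'] at hS
    have : (m : ℂ) * S = centOrderP p g * c * z := by
      apply mul_left_cancel₀ hP0
      rw [← hS]; ring
    field_simp
    rw [this]
    try ring
  have hcop' : Nat.Coprime (centOrderP p g) m := Nat.Coprime.pow_left _ hcop
  have hbez : IsCoprime (centOrderP p g : ℤ) (m : ℤ) := Nat.isCoprime_iff_coprime.mpr hcop'
  obtain ⟨a, b, hab⟩ := hbez
  have habC : (a : ℂ) * centOrderP p g + b * m = 1 := by exact_mod_cast hab
  have : S / (centOrderP p g : ℂ) = a * S + b * (c * z) := by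
    rw [← hmS]
    have e : S = centOrderP p g * (S / (centOrderP p g : ℂ)) := by field_simp
    generalize S / (centOrderP p g : ℂ) = t at *
    rw [e]
    linear_combination (-t) * habC
  rw [this]
  exact ((intCast_isIntegral' a).mul hSint).add
    ((intCast_isIntegral' b).mul ((natCast_isIntegral' c).mul hz))

end helpers

/-- The identity map on `ℤIrr(B)` is a perfect isometry: (sep) the sum
`∑_{χ∈Irr(B)} χ(g) χ̄(h⁻¹)` vanishes if exactly one of `g, h` is `p`-regular, and
(int) this sum divided by the `p`-part of `|C_G(g)|` (resp. `|C_G(h)|`) is an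
algebraic integer. -/
theorem identity_is_perfect (p : ℕ) [Fact p.Prime] (G : Type) [Group G] [Fintype G]
    (B : Finset (G → ℂ)) (hB : IsBlock p G B) :
    (∀ g h : G, Xor' (pRegular p g) (pRegular p h) →
        ∑ χ ∈ B, χ g * (starRingEnd ℂ) (χ h⁻¹) = 0) ∧
    (∀ g h : G,
        IsIntegral ℤ ((∑ χ ∈ B, χ g * (starRingEnd ℂ) (χ h⁻¹)) / (centOrderP p g : ℂ)) ∧
        IsIntegral ℤ ((∑ χ ∈ B, χ g * (starRingEnd ℂ) (χ h⁻¹)) / (centOrderP p h : ℂ))) := by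
  have hconj : ∀ g h : G, ∑ χ ∈ B, χ g * (starRingEnd ℂ) (χ h⁻¹) = ∑ χ ∈ B, χ g * χ h := by
    intro g h
    refine Finset.sum_congr rfl fun χ hχ => ?_
    obtain ⟨V, hV, rfl⟩ := hB.1.1 χ hχ
    rw [char_conj_inv]
  have hsymm : ∀ g h : G, ∑ χ ∈ B, χ g * χ h = ∑ χ ∈ B, χ h * χ g := fun g h =>
    Finset.sum_congr rfl fun χ _ => mul_comm _ _
  refine ⟨fun g h hx => ?_, fun g h => ⟨?_, ?_⟩⟩
  · rw [hconj]
    rcases hx with ⟨h1, h2⟩ | ⟨h1, h2⟩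
    · exact hB.1.2 g h h1 h2
    · rw [hsymm]; exact hB.1.2 h g h1 h2
  · rw [hconj]; exact block_int hB.1 g h
  · rw [hconj, hsymm]; exact block_int hB.1 h g

end
end

section
/- If I : ℤIrr(B) → ℤIrr(B') is a perfect isometry, then (I(χ)(1)·ψ(1))_{p'} ≡ (I(ψ)(1)·χ(1))_{p'} (mod p) for all χ, ψ ∈ Irr(B), where n_{p'} denotes the p'-part of the integer n and the values I(χ)(1) may be negative (with (−n)_{p'} := −(n_{p'})). -/
open scoped BigOperators
open Finset

noncomputable section

/-- The `p'`-part of an integer, with `(-n)_{p'} = -(n_{p'})`. -/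
def pPrimePart (p : ℕ) (n : ℤ) : ℤ := n / ((p : ℤ) ^ (n.natAbs.factorization p))

lemma exists_absval (p : ℕ) [Fact p.Prime] :
    ∃ v : AbsoluteValue ℂ ℝ, IsNonarchimedean v ∧ ∀ q : ℚ, v (q : ℂ) = (padicNorm p q : ℝ) := by
  have hcard : Cardinal.mk (PadicAlgCl p) = Cardinal.continuum := by
    apply le_antisymm
    · refine (Algebra.IsAlgebraic.cardinalMk_le_max ℚ_[p] (PadicAlgCl p)).trans ?_
      refine max_le ?_ Cardinal.aleph0_le_continuum
      have h1 : Cardinal.mk ℚ_[p] ≤ Cardinal.mk (PadicSeq p) := Cardinal.mk_quotient_le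
      refine h1.trans ((Cardinal.mk_subtype_le _).trans ?_)
      simp
    · exact (continuum_le_cardinal_of_nontriviallyNormedField ℚ_[p]).trans
        (Cardinal.mk_le_of_injective (algebraMap ℚ_[p] (PadicAlgCl p)).injective)
  have : IsAlgClosed (PadicAlgCl p) := inferInstanceAs (IsAlgClosed (AlgebraicClosure ℚ_[p]))
  obtain ⟨σ⟩ : Nonempty (ℂ ≃+* PadicAlgCl p) :=
    IsAlgClosed.ringEquiv_of_equiv_of_charZero (by rw [Cardinal.mk_complex]; exact Cardinal.aleph0_lt_continuum)
      (Cardinal.eq.mp (by rw [Cardinal.mk_complex, hcard]))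
  refine ⟨(NormedField.toAbsoluteValue (PadicAlgCl p)).comp (f := σ.toRingHom) σ.injective, ?_, ?_⟩
  · intro a b
    have := PadicAlgCl.isNonarchimedean p (σ a) (σ b)
    rw [← map_add] at this
    exact this
  · intro q
    change ‖σ (q:ℂ)‖ = _
    rw [map_ratCast, ← Padic.eq_padicNorm, ← PadicAlgCl.norm_extends]
    simp

variable {v : AbsoluteValue ℂ ℝ}

lemma vsum_le (hv : IsNonarchimedean v) {ι : Type*} (s : Finset ι) (f : ι → ℂ) (r : ℝ) (hr : 0 ≤ r)
    (h : ∀ i ∈ s, v (f i) ≤ r) : v (∑ i ∈ s, f i) ≤ r := by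
  classical
  induction s using Finset.induction_on with
  | empty => simpa using hr
  | insert a s ha ih =>
    rw [Finset.sum_insert ha]
    exact (hv _ _).trans (max_le (h a (by simp)) (ih fun i hi => h i (by simp [hi])))

lemma vsub_le (hv : IsNonarchimedean v) (a b : ℂ) : v (a - b) ≤ max (v a) (v b) := by
  rw [sub_eq_add_neg]; simpa using hv a (-b)

lemma vint_le (hv : IsNonarchimedean v) {x : ℂ} (hx : IsIntegral ℤ x) : v x ≤ 1 := by
  by_contra hlt
  push Not at hlt
  obtain ⟨f, hf, hfx⟩ := hx
  rw [Polynomial.eval₂_eq_sum_range, Finset.sum_range_succ, hf.coeff_natDegree] at hfx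
  simp only [map_one, one_mul] at hfx
  rcases Nat.eq_zero_or_pos f.natDegree with h0 | h0
  · simp [h0] at hfx
  have h1 : v (x ^ f.natDegree) ≤ v x ^ (f.natDegree - 1) := by
    rw [eq_neg_of_add_eq_zero_right hfx, map_neg_eq_map]
    apply vsum_le hv _ _ _ (by positivity)
    intro i hi
    rw [map_mul, map_pow]
    have : v ((algebraMap ℤ ℂ) (f.coeff i)) ≤ 1 := by
      simpa using hv.apply_intCast_le_one (n := f.coeff i)
    calc _ ≤ 1 * v x ^ i := by gcongr
      _ = v x ^ i := one_mul _
      _ ≤ _ := pow_le_pow_right₀ hlt.le (by have := Finset.mem_range.mp hi; omega)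
  rw [map_pow] at h1
  exact absurd h1 (not_le.mpr (pow_lt_pow_right₀ hlt (by omega)))

lemma v_le_one_of_pow {a K : ℝ} (h : ∀ n : ℕ, a ^ n ≤ K) : a ≤ 1 := by
  by_contra hlt
  push Not at hlt
  obtain ⟨n, hn⟩ := pow_unbounded_of_one_lt K hlt
  exact absurd (h n) (not_le.mpr hn)

/-- if `a ≡ 1` then `a^(p^k) → 1`. -/
lemma v_pow_tendsto (hv : IsNonarchimedean v) (p : ℕ) (hp : v (p : ℂ) < 1) {a : ℂ} (ha : v (a - 1) < 1) :
    ∃ c : ℝ, 0 ≤ c ∧ c < 1 ∧ ∀ k : ℕ, v (a ^ (p ^ k) - 1) ≤ c ^ k := by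
  set c := max (v (p : ℂ)) (v (a - 1)) with hc
  have hc0 : 0 ≤ c := le_max_of_le_left (v.nonneg _)
  have hc1 : c < 1 := max_lt hp ha
  refine ⟨c, hc0, hc1, ?_⟩
  have key : ∀ b : ℂ, v (b - 1) ≤ c → v (b ^ p - 1) ≤ c * v (b - 1) := by
    intro b hb
    have hb1 : v b ≤ 1 := by
      have := hv (b - 1) 1
      simp only [sub_add_cancel, map_one] at this
      exact this.trans (max_le (hb.trans hc1.le) le_rfl)
    rw [← geom_sum_mul b p, map_mul]
    gcongr
    have : ∑ i ∈ range p, b ^ i = p + ∑ i ∈ range p, (b ^ i - 1) := by simp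
    rw [this]
    refine (hv _ _).trans (max_le (le_max_left _ _) ?_)
    apply vsum_le hv _ _ _ hc0
    intro i _
    rw [← geom_sum_mul, map_mul]
    calc _ ≤ 1 * v (b - 1) := by
          gcongr
          apply vsum_le hv _ _ _ zero_le_one
          intro j _
          rw [map_pow]
          exact pow_le_one₀ (v.nonneg _) hb1
      _ ≤ c := by simpa using hb
  have h2 : ∀ k : ℕ, v (a ^ (p ^ k) - 1) ≤ c ^ k * c := by
    intro k
    induction k with
    | zero => simp [hc]
    | succ k ih =>
      have hle : c ^ k * c ≤ c := mul_le_of_le_one_left hc0 (pow_le_one₀ hc0 hc1.le)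
      have := key _ (ih.trans hle)
      rw [← pow_mul, ← pow_succ] at this
      refine this.trans ?_
      calc _ ≤ c * (c ^ k * c) := by gcongr
        _ = _ := by ring
  intro k
  exact (h2 k).trans (mul_le_of_le_one_right (by positivity) hc1.le)

section rep
variable {G : Type} [Group G] [Fintype G]

lemma irr_comm {χ : G → ℂ} (h : IsIrrChar G χ) (a b : G) : χ (a * b) = χ (b * a) := by
  obtain ⟨V, _, rfl⟩ := h
  exact V.char_mul_comm b a

lemma irr_one {χ : G → ℂ} (h : IsIrrChar G χ) : ∃ n : ℕ, n ≠ 0 ∧ χ 1 = n := by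
  obtain ⟨V, hV, rfl⟩ := h
  refine ⟨_, ?_, V.char_one⟩
  intro h0
  have h1 : Module.finrank ℂ (V ⟶ V) = 1 := by
    rw [FDRep.finrank_hom_simple_simple, if_pos ⟨CategoryTheory.Iso.refl V⟩]
  have hsub : Subsingleton V := Module.finrank_zero_iff.mp h0
  apply CategoryTheory.id_nonzero V
  apply Action.Hom.ext
  ext x
  exact Subsingleton.elim _ _

lemma irr_int {χ : G → ℂ} (h : IsIrrChar G χ) (g : G) : IsIntegral ℤ (χ g) := by
  obtain ⟨V, hV, rfl⟩ := h
  change IsIntegral ℤ (LinearMap.trace ℂ V (V.ρ g))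
  let b := Module.finBasis ℂ V
  rw [LinearMap.trace_eq_matrix_trace ℂ b, Matrix.trace_eq_sum_roots_charpoly]
  apply IsIntegral.multiset_sum
  intro r hr
  rw [LinearMap.charpoly_toMatrix] at hr
  have hev := (Module.End.hasEigenvalue_iff_isRoot_charpoly _ _).mpr (Polynomial.isRoot_of_mem_roots hr)
  obtain ⟨x, hx⟩ := hev.exists_hasEigenvector
  have hpow := hx.pow_apply (orderOf g)
  rw [← map_pow, pow_orderOf_eq_one, map_one, Module.End.one_apply] at hpow
  have h1 : r ^ orderOf g = 1 := by
    have h3 : (r ^ orderOf g - 1) • x = 0 := by rw [sub_smul, ← hpow, one_smul, sub_self]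
    rcases smul_eq_zero.mp h3 with h4 | h4
    · exact sub_eq_zero.mp h4
    · exact absurd h4 hx.2
  apply IsIntegral.of_pow (orderOf_pos g)
  rw [h1]; exact isIntegral_one

lemma irr_key {χ : G → ℂ} (h : IsIrrChar G χ) (a : G → ℂ) (ha : ∀ t g, a (t * g * t⁻¹) = a g)
    (b : G) : ∑ g, a g * χ (g * b) = (∑ g, a g * χ g) / χ 1 * χ b := by
  obtain ⟨n, hn, hn1⟩ := irr_one h
  obtain ⟨V, hV, rfl⟩ := h
  let f : V →ₗ[ℂ] V := ∑ g, a g • V.ρ g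
  have hf : ∀ t, V.ρ t * f = f * V.ρ t := by
    intro t
    simp only [f, Finset.mul_sum, Finset.sum_mul]
    apply Fintype.sum_equiv (MulAut.conj t).toEquiv
    intro g
    simp [ha, ← map_mul]
  obtain ⟨c, hc⟩ : ∃ c : ℂ, f = c • 1 := by
    let F : V ⟶ V := ⟨CategoryTheory.InducedCategory.homMk (ModuleCat.ofHom f), fun g ↦ by
      ext x
      exact (LinearMap.congr_fun (hf g) x).symm⟩
    obtain ⟨c, hc⟩ := CategoryTheory.endomorphism_simple_eq_smul_id ℂ F
    refine ⟨c, ?_⟩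
    ext x
    have := congrArg (fun F : V ⟶ V => F.hom.hom.hom x) hc
    exact this.symm
  have tr : ∀ b, ∑ g, a g * V.character (g * b) = c * V.character b := by
    intro b
    have : LinearMap.trace ℂ V (f * V.ρ b) = c * V.character b := by
      rw [hc]; simp [FDRep.character]
    rw [← this]
    simp [f, Finset.sum_mul, FDRep.character]
  have t1 := tr 1
  simp only [mul_one] at t1
  rw [tr b, t1, mul_div_assoc, div_self, mul_one]
  rw [hn1]; exact_mod_cast hn

lemma irr_orth {χ ψ : G → ℂ} (h : IsIrrChar G χ) (h' : IsIrrChar G ψ) [Decidable (χ = ψ)] :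
    ∑ g, χ g * ψ g⁻¹ = if χ = ψ then (Fintype.card G : ℂ) else 0 := by
  classical
  obtain ⟨V, hV, rfl⟩ := h
  obtain ⟨W, hW, rfl⟩ := h'
  have hc : (Nat.card G : ℂ) ≠ 0 := by simp
  let _ : Invertible (Nat.card G : ℂ) := invertibleOfNonzero hc
  have := FDRep.char_orthonormal V W
  rw [inv_mul_eq_iff_eq_mul₀ hc] at this
  rw [this, ← Nat.card_eq_fintype_card]
  by_cases hVW : Nonempty (V ≅ W)
  · rw [if_pos hVW, if_pos (FDRep.char_iso hVW.some)]; simp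
  · rw [if_neg hVW]
    by_cases e : V.character = W.character
    · exfalso
      have h2 := FDRep.char_orthonormal V V
      rw [if_pos ⟨CategoryTheory.Iso.refl V⟩, inv_mul_eq_iff_eq_mul₀ hc] at h2
      rw [← e, h2, if_neg hVW] at this
      simp at this
    · rw [if_neg e]; simp

lemma irr_sub {χ : G → ℂ} (h : IsIrrChar G χ) (P : Subgroup G) [Fintype P] :
    ∃ n : ℕ, ∑ x : P, χ x = n * (Nat.card P : ℂ) := by
  classical
  obtain ⟨V, hV, rfl⟩ := h
  have hc : (Nat.card P : ℂ) ≠ 0 := by simp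
  let _ : Invertible (Nat.card P : ℂ) := invertibleOfNonzero hc
  have := FDRep.average_char_eq_finrank_invariants (FDRep.of (V.ρ.comp P.subtype))
  rw [inv_mul_eq_iff_eq_mul₀ hc] at this
  rw [mul_comm] at this
  exact ⟨_, this⟩
end rep

section words
variable {v : AbsoluteValue ℂ ℝ}

lemma perm_sum_le (hv : IsNonarchimedean v) {p : ℕ} (hp : p.Prime) (hp1 : v (p : ℂ) ≤ 1)
    {X : Type} [Fintype X] (σ : Equiv.Perm X) (F : X → ℂ) (hF : ∀ x, F (σ x) = F x)
    (hF1 : ∀ x, v (F x) ≤ 1) (k m : ℕ) (hσ : ∀ x, σ^[p ^ k] x = x)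
    (hper : ∀ x, F x ≠ 0 → σ^[p ^ m] x ≠ x) : v (∑ x, F x) ≤ v (p : ℂ) ^ m := by
  classical
  let Z := Subgroup.zpowers σ
  let q : X → Quotient (MulAction.orbitRel Z X) := fun x => Quotient.mk _ x
  have hinv : ∀ x y, q x = q y → F x = F y := by
    intro x y h
    obtain ⟨⟨g, hg⟩, rfl⟩ := MulAction.orbitRel_apply.mp (Quotient.exact h)
    obtain ⟨n, rfl⟩ := Subgroup.mem_zpowers_iff.mp hg
    change F ((σ ^ n) y) = F y
    clear h hg
    induction n using Int.induction_on with
    | zero => simp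
    | succ i ih =>
      rw [add_comm, zpow_add, zpow_one, Equiv.Perm.mul_apply, hF]
      exact ih
    | pred i ih =>
      rw [sub_eq_add_neg, add_comm, zpow_add, zpow_neg, zpow_one, Equiv.Perm.mul_apply, ← hF,
        ← Equiv.Perm.mul_apply, mul_inv_cancel, Equiv.Perm.one_apply]
      exact ih
  rw [← Finset.sum_fiberwise (s := univ) (g := q)]
  apply vsum_le hv _ _ _ (by positivity)
  intro ω _
  obtain ⟨x, rfl⟩ := Quotient.exists_rep ω
  rw [Finset.sum_congr rfl (g := fun _ => F x) (fun y hy => hinv _ _ (by simpa [q] using hy)), sum_const, nsmul_eq_mul, map_mul]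
  by_cases hx : F x = 0
  · simp [hx]
  have hcard : (univ.filter fun y => q y = Quotient.mk _ x).card = Function.minimalPeriod σ x := by
    rw [show Function.minimalPeriod σ x = Function.minimalPeriod (σ • ·) x from rfl,
      MulAction.minimalPeriod_eq_card, ← Set.toFinset_card]
    congr 1
    ext y
    simp only [mem_filter, mem_univ, true_and, Set.mem_toFinset, q]
    rw [← MulAction.orbitRel_apply]
    exact Quotient.eq
  have hdvd : Function.minimalPeriod σ x ∣ p ^ k := Function.IsPeriodicPt.minimalPeriod_dvd (hσ x)
  obtain ⟨i, hi, hi'⟩ := (Nat.dvd_prime_pow hp).mp hdvd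
  have him : m ≤ i := by
    by_contra hlt
    apply hper x hx
    have : Function.IsPeriodicPt σ (p ^ m) x := by
      rw [Function.isPeriodicPt_iff_minimalPeriod_dvd, hi']
      exact pow_dvd_pow _ (by omega)
    exact this
  rw [hcard, hi']
  push_cast
  rw [map_pow]
  calc _ ≤ v (p : ℂ) ^ i * 1 := by gcongr; exact hF1 x
    _ = v (p : ℂ) ^ i := mul_one _
    _ ≤ _ := pow_le_pow_of_le_one (v.nonneg _) hp1 him

variable {G : Type} [Group G]

/-- partial product of a cyclic word -/
def wprod {n : ℕ} [NeZero n] (w : Fin n → G) (m : ℕ) : G :=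
  ((List.range m).map fun i => w (Fin.ofNat n i)).prod

/-- the shift -/
def wshift (n : ℕ) [NeZero n] : Equiv.Perm (Fin n → G) :=
  Equiv.arrowCongr (Equiv.addRight (1 : Fin n)).symm (Equiv.refl G)

lemma wshift_apply {n : ℕ} [NeZero n] (w : Fin n → G) (i : Fin n) : wshift n w i = w (i + 1) := rfl

lemma ofNat_succ' {n : ℕ} [NeZero n] (i : ℕ) : Fin.ofNat n i + 1 = Fin.ofNat n (i + 1) := by
  ext; simp [Fin.val_add]

lemma wprod_succ {n : ℕ} [NeZero n] (w : Fin n → G) (m : ℕ) :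
    wprod w (m + 1) = w 0 * wprod (wshift n w) m := by
  simp only [wprod, List.range_succ_eq_map, List.map_cons, List.prod_cons, List.map_map]
  congr 3
  ext i
  rw [wshift_apply, ofNat_succ']
  rfl

lemma wprod_succ' {n : ℕ} [NeZero n] (w : Fin n → G) (m : ℕ) :
    wprod w (m + 1) = wprod w m * w (Fin.ofNat n m) := by
  simp [wprod, List.range_succ]

lemma wprod_shift {n : ℕ} [NeZero n] (w : Fin n → G) :
    wprod (wshift n w) n = (w 0)⁻¹ * wprod w n * w 0 := by
  have h := wprod_succ w n
  rw [wprod_succ'] at h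
  have : Fin.ofNat n n = 0 := by ext; simp
  rw [this] at h
  rw [mul_assoc, h]; simp

lemma wprod_add {n : ℕ} [NeZero n] (a b : ℕ) (w : Fin n → G) :
    wprod w (a + b) = wprod w a * wprod ((wshift n)^[a] w) b := by
  induction a generalizing w with
  | zero => simp [wprod]
  | succ a ih => rw [add_right_comm, wprod_succ, ih, wprod_succ, mul_assoc]; rfl

lemma wprod_mul {n : ℕ} [NeZero n] (m : ℕ) (w : Fin n → G) (h : (wshift n)^[m] w = w) (r : ℕ) :
    wprod w (m * r) = wprod w m ^ r := by
  induction r with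
  | zero => simp [wprod]
  | succ r ih => rw [mul_add, mul_one, add_comm, wprod_add, h, ih, pow_succ']

lemma wshift_iter {n : ℕ} [NeZero n] (m : ℕ) (w : Fin n → G) (i : Fin n) :
    (wshift n)^[m] w i = w (i + Fin.ofNat n m) := by
  induction m generalizing w with
  | zero => simp
  | succ m ih => rw [Function.iterate_succ_apply, ih, wshift_apply, add_assoc, ofNat_succ']

lemma wshift_n {n : ℕ} [NeZero n] (w : Fin n → G) : (wshift n)^[n] w = w := by
  ext i
  rw [wshift_iter]
  have : Fin.ofNat n n = 0 := by ext; simp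
  simp [this]

lemma ofFn_prod {n : ℕ} [NeZero n] (w : Fin n → G) : (List.ofFn w).prod = wprod w n := by
  unfold wprod
  congr 1
  apply List.ext_getElem
  · simp
  · intro i h1 h2
    simp only [List.getElem_ofFn, List.getElem_map, List.getElem_range]
    congr 1
    ext
    simp at h1
    simp [Nat.mod_eq_of_lt h1]

lemma ofFn_single {n : ℕ} (w : Fin n → G) (f : G → ℂ) :
    (List.ofFn fun i => MonoidAlgebra.single (w i) (f (w i))).prod =
      MonoidAlgebra.single (List.ofFn w).prod (∏ i, f (w i)) := by
  induction n with
  | zero => simp [MonoidAlgebra.one_def]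
  | succ n ih =>
    rw [List.ofFn_succ, List.prod_cons, ih (fun i => w i.succ), MonoidAlgebra.single_mul_single,
      List.ofFn_succ, List.prod_cons, Fin.prod_univ_succ]

variable [Fintype G]

lemma ma_pow (u : MonoidAlgebra ℂ G) (n : ℕ) [NeZero n] :
    u ^ n = ∑ w : Fin n → G, MonoidAlgebra.single (wprod w n) (∏ i, u.coeff (w i)) := by
  classical
  have hu : u = ∑ g, MonoidAlgebra.single g (u.coeff g) := by
    ext g
    simp [Finsupp.single_apply]
  conv_lhs => rw [hu]
  rw [← MultilinearMap.mkPiAlgebraFin_apply_const (R := ℂ) (n := n), MultilinearMap.map_sum]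
  apply Finset.sum_congr rfl
  intro w _
  rw [MultilinearMap.mkPiAlgebraFin_apply, ofFn_single w u.coeff, ofFn_prod]

lemma trace_est (hv : IsNonarchimedean v) {p : ℕ} (hp : p.Prime) (hp1 : v (p : ℂ) ≤ 1)
    (u : MonoidAlgebra ℂ G) (hu : ∀ g, v (u.coeff g) ≤ 1) (y : G) (hy : ¬ pRegular p y)
    (b m : ℕ) (hb : ∀ g : G, pRegular p (g ^ p ^ b)) :
    v (∑ t, (u ^ (p ^ (m + b))).coeff (t * y * t⁻¹)) ≤ v (p : ℂ) ^ m := by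
  classical
  have : NeZero (p ^ (m + b)) := ⟨pow_ne_zero _ hp.ne_zero⟩
  set n := p ^ (m + b) with hn
  let N : G → ℕ := fun g => (univ.filter fun t => t * y * t⁻¹ = g).card
  have hN : ∀ g a : G, N (a⁻¹ * g * a) = N g := by
    intro g a
    apply Finset.card_bij (fun t _ => a * t)
    · intro t ht
      simp only [mem_filter, mem_univ, true_and] at ht ⊢
      rw [mul_inv_rev]
      calc a * t * y * (t⁻¹ * a⁻¹) = a * (t * y * t⁻¹) * a⁻¹ := by group
        _ = g := by rw [ht]; group
    · intro t _ t' _ h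
      exact mul_left_cancel h
    · intro t ht
      simp only [mem_filter, mem_univ, true_and] at ht
      refine ⟨a⁻¹ * t, ?_, by simp⟩
      simp only [mem_filter, mem_univ, true_and]
      rw [← ht]; group
  have e : ∑ t, (u ^ n).coeff (t * y * t⁻¹) =
      ∑ w : Fin n → G, (∏ i, u.coeff (w i)) * (N (wprod w n) : ℂ) := by
    rw [ma_pow]
    simp only [MonoidAlgebra.coeff_sum, Finsupp.coe_finsetSum, Finset.sum_apply, MonoidAlgebra.coeff_single,
      Finsupp.single_apply]
    rw [Finset.sum_comm]
    apply Finset.sum_congr rfl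
    intro w _
    rw [← Finset.sum_filter, sum_const, nsmul_eq_mul, mul_comm]
    simp only [N, eq_comm]
  rw [e]
  apply perm_sum_le hv hp hp1 (wshift n) _ _ _ (m + b) m wshift_n
  · intro w hw hfix
    have h1 := wprod_mul (p ^ m) w hfix (p ^ b)
    rw [← pow_add] at h1
    have h2 : N (wprod w n) ≠ 0 := by
      intro h0; apply hw; simp [h0]
    obtain ⟨t, ht⟩ := Finset.card_ne_zero.mp h2
    simp only [mem_filter, mem_univ, true_and] at ht
    apply hy
    have h3 := hb (wprod w (p ^ m))
    rw [← h1] at h3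
    change pRegular p (wprod w n) at h3
    rw [← ht] at h3
    have : orderOf (t * y * t⁻¹) = orderOf y := by
      have := MulEquiv.orderOf_eq (MulAut.conj t) y
      simpa using this
    unfold pRegular at h3 ⊢
    rwa [this] at h3
  · intro w
    rw [wprod_shift, hN]
    congr 1
    exact Fintype.prod_equiv (Equiv.addRight (1 : Fin n)) _ _ (fun i => rfl)
  · intro w
    rw [map_mul, map_prod]
    refine mul_le_one₀ (Finset.prod_le_one (fun i _ => v.nonneg _) (fun i _ => hu _)) (v.nonneg _) ?_
    exact hv.apply_natCast_le_one
end words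

section link
variable {v : AbsoluteValue ℂ ℝ} {G : Type} [Group G] [Fintype G]

/-- group algebra element from a function -/
def maOf (f : G → ℂ) : MonoidAlgebra ℂ G := MonoidAlgebra.ofCoeff (Finsupp.equivFunOnFinite.symm f)

@[simp] lemma maOf_coeff (f : G → ℂ) (g : G) : (maOf f).coeff g = f g := rfl

lemma ma_mul (x y : MonoidAlgebra ℂ G) (g : G) :
    (x * y).coeff g = ∑ a, x.coeff a * y.coeff (a⁻¹ * g) := by
  rw [MonoidAlgebra.coeff_mul_apply_left, Finsupp.sum_fintype]
  simp

/-- class function condition -/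
def IsCl (z : MonoidAlgebra ℂ G) : Prop := ∀ t g, z.coeff (t * g * t⁻¹) = z.coeff g

/-- integral coefficients -/
def IsO (v : AbsoluteValue ℂ ℝ) (z : MonoidAlgebra ℂ G) : Prop := ∀ g, v (z.coeff g) ≤ 1

lemma IsCl.one : IsCl (1 : MonoidAlgebra ℂ G) := by
  classical
  intro t g
  simp [MonoidAlgebra.one_def, Finsupp.single_apply, eq_comm (a := (1 : G))]

lemma IsCl.mul {x y : MonoidAlgebra ℂ G} (hx : IsCl x) (hy : IsCl y) : IsCl (x * y) := by
  intro t g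
  rw [ma_mul, ma_mul]
  symm
  apply Fintype.sum_equiv (MulAut.conj t).toEquiv
  intro a
  simp only [MulEquiv.toEquiv_eq_coe, EquivLike.coe_coe, MulAut.conj_apply]
  rw [hx, ← hy t (a⁻¹ * g)]
  congr 2
  group

lemma IsCl.sub {x y : MonoidAlgebra ℂ G} (hx : IsCl x) (hy : IsCl y) : IsCl (x - y) := by
  intro t g
  simp [hx t g, hy t g]

lemma IsCl.smul {x : MonoidAlgebra ℂ G} (c : ℂ) (hx : IsCl x) : IsCl (c • x) := by
  intro t g
  simp [hx t g]

lemma IsCl.pow {x : MonoidAlgebra ℂ G} (hx : IsCl x) (n : ℕ) : IsCl (x ^ n) := by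
  induction n with
  | zero => simpa using IsCl.one
  | succ n ih => rw [pow_succ]; exact ih.mul hx

lemma IsO.one : IsO v (1 : MonoidAlgebra ℂ G) := by
  classical
  intro g
  simp only [MonoidAlgebra.one_def, MonoidAlgebra.coeff_single, Finsupp.single_apply]
  split_ifs <;> simp

lemma IsO.mul (hv : IsNonarchimedean v) {x y : MonoidAlgebra ℂ G} (hx : IsO v x) (hy : IsO v y) :
    IsO v (x * y) := by
  intro g
  rw [ma_mul]
  apply vsum_le hv _ _ _ zero_le_one
  intro a _
  rw [map_mul]
  exact mul_le_one₀ (hx _) (v.nonneg _) (hy _)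

lemma IsO.sub (hv : IsNonarchimedean v) {x y : MonoidAlgebra ℂ G} (hx : IsO v x) (hy : IsO v y) :
    IsO v (x - y) := by
  intro g
  simp only [MonoidAlgebra.coeff_sub, Finsupp.sub_apply]
  exact (vsub_le hv _ _).trans (max_le (hx _) (hy _))

lemma IsO.smul {x : MonoidAlgebra ℂ G} {c : ℂ} (hc : v c ≤ 1) (hx : IsO v x) : IsO v (c • x) := by
  intro g
  simp only [MonoidAlgebra.coeff_smul_apply, smul_eq_mul, map_mul]
  exact mul_le_one₀ hc (v.nonneg _) (hx _)

lemma IsO.pow (hv : IsNonarchimedean v) {x : MonoidAlgebra ℂ G} (hx : IsO v x) (n : ℕ) :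
    IsO v (x ^ n) := by
  induction n with
  | zero => simpa using IsO.one
  | succ n ih => rw [pow_succ]; exact ih.mul hv hx

/-- central character -/
def lam (χ : G → ℂ) (z : MonoidAlgebra ℂ G) : ℂ := (∑ g, z.coeff g * χ g) / χ 1

lemma irr_ne {χ : G → ℂ} (h : IsIrrChar G χ) : χ 1 ≠ 0 := by
  obtain ⟨n, hn, e⟩ := irr_one h
  rw [e]; exact_mod_cast hn

lemma lam_one {χ : G → ℂ} (h : IsIrrChar G χ) : lam χ 1 = 1 := by
  classical
  unfold lam
  rw [div_eq_one_iff_eq (irr_ne h)]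
  simp [MonoidAlgebra.one_def, Finsupp.single_apply]

lemma lam_sub (χ : G → ℂ) (x y : MonoidAlgebra ℂ G) : lam χ (x - y) = lam χ x - lam χ y := by
  simp [lam, sub_mul, sub_div]

lemma lam_smul (χ : G → ℂ) (c : ℂ) (y : MonoidAlgebra ℂ G) : lam χ (c • y) = c * lam χ y := by
  simp [lam, mul_assoc, ← Finset.mul_sum, mul_div_assoc]

lemma lam_sum (χ : G → ℂ) {ι : Type*} (s : Finset ι) (f : ι → MonoidAlgebra ℂ G) :
    lam χ (∑ i ∈ s, f i) = ∑ i ∈ s, lam χ (f i) := by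
  simp only [lam, MonoidAlgebra.coeff_sum, Finsupp.coe_finsetSum, Finset.sum_apply, Finset.sum_mul,
    ← Finset.sum_div]
  rw [Finset.sum_comm]

lemma lam_mul {χ : G → ℂ} (h : IsIrrChar G χ) {x : MonoidAlgebra ℂ G} (hx : IsCl x)
    (y : MonoidAlgebra ℂ G) : lam χ (x * y) = lam χ x * lam χ y := by
  have : ∑ g, (x * y).coeff g * χ g = lam χ x * ∑ g, y.coeff g * χ g := by
    calc _ = ∑ a, ∑ g, x.coeff a * y.coeff (a⁻¹ * g) * χ g := by
          simp only [ma_mul, Finset.sum_mul]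
          rw [Finset.sum_comm]
      _ = ∑ a, ∑ b, x.coeff a * y.coeff b * χ (a * b) := by
          apply Finset.sum_congr rfl
          intro a _
          symm
          apply Fintype.sum_equiv (Equiv.mulLeft a)
          intro b
          simp
      _ = ∑ b, y.coeff b * ∑ a, x.coeff a * χ (a * b) := by
          rw [Finset.sum_comm]
          simp only [Finset.mul_sum]
          apply Finset.sum_congr rfl
          intro b _
          apply Finset.sum_congr rfl
          intro a _
          ring
      _ = _ := by
          rw [Finset.mul_sum]
          apply Finset.sum_congr rfl
          intro b _
          rw [irr_key h _ hx b]
          unfold lam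
          ring
  rw [lam, this, lam, lam]
  ring

lemma lam_pow {χ : G → ℂ} (h : IsIrrChar G χ) {x : MonoidAlgebra ℂ G} (hx : IsCl x) (n : ℕ) :
    lam χ (x ^ n) = lam χ x ^ n := by
  induction n with
  | zero => simpa using lam_one h
  | succ n ih => rw [pow_succ, pow_succ, lam_mul h (hx.pow n), ih]

lemma lam_le (hv : IsNonarchimedean v) {χ : G → ℂ} (h : IsIrrChar G χ) {x : MonoidAlgebra ℂ G}
    (hx : IsCl x) (hxo : IsO v x) : v (lam χ x) ≤ 1 := by
  apply v_le_one_of_pow (K := 1 / v (χ 1))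
  intro n
  rw [← map_pow, ← lam_pow h hx, lam, map_div₀]
  gcongr
  apply vsum_le hv _ _ _ zero_le_one
  intro g _
  rw [map_mul]
  exact mul_le_one₀ (hxo.pow hv n g) (v.nonneg _) (vint_le hv (irr_int h g))

/-- central idempotent -/
def eid (χ : G → ℂ) : MonoidAlgebra ℂ G := maOf fun g => χ 1 / Fintype.card G * χ g⁻¹

lemma mul_eid {χ : G → ℂ} (h : IsIrrChar G χ) {z : MonoidAlgebra ℂ G} (hz : IsCl z) :
    z * eid χ = lam χ z • eid χ := by
  ext g
  rw [ma_mul]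
  simp only [eid, maOf_coeff, MonoidAlgebra.coeff_smul_apply, smul_eq_mul]
  have := irr_key h _ hz g⁻¹
  rw [show lam χ z * (χ 1 / Fintype.card G * χ g⁻¹) = χ 1 / Fintype.card G * (lam χ z * χ g⁻¹) by ring,
    lam, ← this, Finset.mul_sum]
  apply Finset.sum_congr rfl
  intro a _
  rw [irr_comm h a g⁻¹]
  simp only [mul_inv_rev, inv_inv]
  ring

lemma irr_conj {χ : G → ℂ} (h : IsIrrChar G χ) (a b : G) :
    ∑ t, χ (t * a * t⁻¹ * b) = Fintype.card G * χ a / χ 1 * χ b := by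
  classical
  let N : G → ℂ := fun g => ∑ t : G, if t * a * t⁻¹ = g then 1 else 0
  have hN : ∀ t g, N (t * g * t⁻¹) = N g := by
    intro s g
    symm
    apply Fintype.sum_equiv (Equiv.mulLeft s)
    intro t
    congr 1
    simp only [Equiv.coe_mulLeft, mul_inv_rev, eq_iff_iff]
    constructor
    · rintro rfl; group
    · intro h
      have : s * (t * a * t⁻¹) * s⁻¹ = s * g * s⁻¹ := by rw [← h]; group
      simpa using this
  have hs : ∀ b, ∑ g, N g * χ (g * b) = ∑ t, χ (t * a * t⁻¹ * b) := by
    intro b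
    simp only [N, Finset.sum_mul]
    rw [Finset.sum_comm]
    simp
  have h1 : ∑ g, N g * χ g = Fintype.card G * χ a := by
    have := hs 1
    simp only [mul_one] at this
    rw [this]
    have h2 : ∀ t, χ (t * a * t⁻¹) = χ a := by
      intro t; rw [irr_comm h, inv_mul_cancel_left]
    simp [h2]
  rw [← hs, irr_key h N hN, h1]

lemma irr_inner {χ ψ : G → ℂ} (h : IsIrrChar G χ) (h' : IsIrrChar G ψ) [Decidable (χ = ψ)] :
    lam χ (eid ψ) = if χ = ψ then 1 else 0 := by
  have hc : (Fintype.card G : ℂ) ≠ 0 := by simp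
  unfold lam eid
  have := irr_orth h h'
  simp only [maOf_coeff]
  have e : ∑ g, ψ 1 / Fintype.card G * ψ g⁻¹ * χ g = ψ 1 / Fintype.card G * ∑ g, χ g * ψ g⁻¹ := by
    rw [Finset.mul_sum]
    apply Finset.sum_congr rfl
    intro g _; ring
  rw [e, this]
  split_ifs with hh
  · subst hh
    have := irr_ne h
    field_simp
  · simp

/-- block idempotent -/
def fB (B : Finset (G → ℂ)) : MonoidAlgebra ℂ G := ∑ χ ∈ B, eid χ

lemma fB_coeff (B : Finset (G → ℂ)) (g : G) :
    (fB B).coeff g = (∑ χ ∈ B, χ 1 * χ g⁻¹) / Fintype.card G := by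
  simp only [fB, MonoidAlgebra.coeff_sum, Finsupp.coe_finsetSum, Finset.sum_apply, eid, maOf_coeff,
    Finset.sum_div]
  apply Finset.sum_congr rfl
  intro χ _
  ring

lemma lam_fB {B : Finset (G → ℂ)} (hB : ∀ χ ∈ B, IsIrrChar G χ) {χ : G → ℂ} (h : χ ∈ B) :
    lam χ (fB B) = 1 := by
  classical
  rw [fB, lam_sum, Finset.sum_congr rfl (fun ψ hψ => irr_inner (hB χ h) (hB ψ hψ))]
  simp [h]

lemma fB_isCl {B : Finset (G → ℂ)} (hB : ∀ χ ∈ B, IsIrrChar G χ) : IsCl (fB B) := by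
  intro t g
  rw [fB_coeff, fB_coeff]
  congr 1
  apply Finset.sum_congr rfl
  intro χ hχ
  have : (t * g * t⁻¹)⁻¹ = t * (g⁻¹ * t⁻¹) := by group
  rw [this, irr_comm (hB χ hχ)]
  simp

lemma v_card {p : ℕ} [Fact p.Prime] (hvp : ∀ q : ℚ, v (q : ℂ) = (padicNorm p q : ℝ)) {n : ℕ} (hn : n ≠ 0) :
    v (n : ℂ) = v (pPart p n : ℂ) := by
  have hp : p.Prime := Fact.out
  have h1 : ((n : ℕ) : ℂ) = (pPart p n : ℂ) * ((n / p ^ n.factorization p : ℕ) : ℂ) := by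
    unfold pPart
    exact_mod_cast (Nat.ordProj_mul_ordCompl_eq_self n p).symm
  have h2 : v ((n / p ^ n.factorization p : ℕ) : ℂ) = 1 := by
    have := hvp ((n / p ^ n.factorization p : ℕ) : ℚ)
    rw [Rat.cast_natCast] at this
    rw [this]
    have := (padicNorm.nat_eq_one_iff (p := p) (n / p ^ n.factorization p)).mpr (Nat.not_dvd_ordCompl hp hn)
    exact_mod_cast this
  rw [h1, map_mul, h2, mul_one]

lemma pReg_one (p : ℕ) [Fact p.Prime] : pRegular p (1 : G) := by
  unfold pRegular
  rw [orderOf_one]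
  exact (Fact.out : p.Prime).one_lt.ne' ∘ Nat.dvd_one.mp

lemma pReg_inv {p : ℕ} {g : G} : pRegular p g⁻¹ ↔ pRegular p g := by
  unfold pRegular; rw [orderOf_inv]

lemma fB_isO (hv : IsNonarchimedean v) {p : ℕ} [Fact p.Prime]
    (hvp : ∀ q : ℚ, v (q : ℂ) = (padicNorm p q : ℝ)) {B : Finset (G → ℂ)}
    (hB : IsBlockUnion p G B) : IsO v (fB B) := by
  classical
  have hp : p.Prime := Fact.out
  intro g
  rw [fB_coeff]
  by_cases hg : pRegular p g
  · obtain ⟨P⟩ : Nonempty (Sylow p G) := inferInstance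
    have hPc : Nat.card (P : Subgroup G) = pPart p (Fintype.card G) := by
      rw [P.card_eq_multiplicity, Nat.card_eq_fintype_card]; rfl
    choose! n hn using fun χ (hχ : χ ∈ B) => irr_sub (hB.1 χ hχ) (P : Subgroup G)
    have e1 : ∑ x : (P : Subgroup G), ∑ χ ∈ B, χ g⁻¹ * χ x = ∑ χ ∈ B, χ 1 * χ g⁻¹ := by
      rw [Finset.sum_eq_single (1 : (P : Subgroup G))]
      · simp [mul_comm]
      · intro x _ hx
        apply hB.2 _ _ (pReg_inv.mpr hg)
        unfold pRegular
        push Not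
        obtain ⟨k, hk⟩ := P.isPGroup'.exists_orderOf_eq_pow x 
        rw [Subgroup.orderOf_coe, hk]
        apply dvd_pow_self
        rintro rfl
        apply hx
        rw [← orderOf_eq_one_iff, hk, pow_zero]
      · simp
    have e2 : ∑ χ ∈ B, χ 1 * χ g⁻¹ = (∑ χ ∈ B, χ g⁻¹ * (n χ : ℂ)) * (pPart p (Fintype.card G) : ℂ) := by
      rw [← e1, Finset.sum_comm, Finset.sum_mul, ← hPc]
      apply Finset.sum_congr rfl
      intro χ hχ
      rw [← Finset.mul_sum, hn χ hχ, mul_assoc]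
    have hc : v (pPart p (Fintype.card G) : ℂ) ≠ 0 := by
      rw [v.ne_zero_iff]
      unfold pPart
      exact_mod_cast pow_ne_zero _ hp.ne_zero
    rw [map_div₀, v_card hvp Fintype.card_ne_zero, e2, map_mul, mul_div_assoc, div_self hc, mul_one]
    apply vsum_le hv _ _ _ zero_le_one
    intro χ hχ
    rw [map_mul]
    exact mul_le_one₀ (vint_le hv (irr_int (hB.1 χ hχ) _)) (v.nonneg _) hv.apply_natCast_le_one
  · rw [hB.2 1 g⁻¹ (pReg_one p) (by rwa [pReg_inv])]
    simp
end link

section link2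
variable {v : AbsoluteValue ℂ ℝ} {G : Type} [Group G] [Fintype G]

lemma exists_b (p : ℕ) [Fact p.Prime] :
    ∃ b : ℕ, ∀ g : G, pRegular p (g ^ p ^ b) := by
  have hp : p.Prime := Fact.out
  refine ⟨(Fintype.card G).factorization p, fun g hd => ?_⟩
  have h1 : orderOf (g ^ p ^ (Fintype.card G).factorization p) ∣
      Fintype.card G / p ^ (Fintype.card G).factorization p := by
    apply orderOf_dvd_of_pow_eq_one
    rw [← pow_mul, Nat.ordProj_mul_ordCompl_eq_self, pow_card_eq_one]
  exact Nat.not_dvd_ordCompl hp Fintype.card_ne_zero (hd.trans h1)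

lemma exists_m (p : ℕ) [Fact p.Prime] (b : ℕ) (x : G) (hx : pRegular p x) (j : ℕ) :
    ∃ m, j ≤ m ∧ x ^ (p ^ (m + b)) = x := by
  have hp : p.Prime := Fact.out
  have hco : Nat.Coprime p (orderOf x) := (Nat.Prime.coprime_iff_not_dvd hp).mpr hx
  have h0 : 0 < orderOf x := orderOf_pos x
  have ht : 0 < Nat.totient (orderOf x) := Nat.totient_pos.mpr h0
  have hle : j + b ≤ Nat.totient (orderOf x) * (j + b) := Nat.le_mul_of_pos_left _ ht
  refine ⟨Nat.totient (orderOf x) * (j + b) - b, by omega, ?_⟩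
  rw [show Nat.totient (orderOf x) * (j + b) - b + b = Nat.totient (orderOf x) * (j + b) by omega]
  have h1 : p ^ (Nat.totient (orderOf x) * (j + b)) ≡ 1 [MOD orderOf x] := by
    rw [pow_mul]
    simpa using (Nat.ModEq.pow_totient hco).pow (j + b)
  have := (pow_eq_pow_iff_modEq (x := x)).mpr h1
  simpa using this

lemma IsCl.comm_single {Z : MonoidAlgebra ℂ G} (hZ : IsCl Z) (x : G) :
    Commute (MonoidAlgebra.single x (1:ℂ)) Z := by
  unfold Commute SemiconjBy
  ext g
  rw [MonoidAlgebra.coeff_single_mul_apply, MonoidAlgebra.coeff_mul_single_apply]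
  rw [one_mul, mul_one, ← hZ x (x⁻¹ * g)]
  congr 1
  group

lemma block_est (hv : IsNonarchimedean v) {p : ℕ} [Fact p.Prime]
    (hvp : ∀ q : ℚ, v (q : ℂ) = (padicNorm p q : ℝ)) {B : Finset (G → ℂ)}
    (hB : IsBlockUnion p G B) {Z0 : MonoidAlgebra ℂ G} (hc : IsCl Z0) (ho : IsO v Z0)
    (hp1 : v (p : ℂ) ≤ 1)
    {x y : G} (hy : ¬ pRegular p y) {b m : ℕ} (hb : ∀ g : G, pRegular p (g ^ p ^ b))
    (hx : x ^ (p ^ (m + b)) = x) :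
    v (∑ χ ∈ B, (lam χ Z0) ^ (p ^ (m + b)) * (χ x * χ y⁻¹)) ≤ v (p : ℂ) ^ m := by
  have hp : p.Prime := Fact.out
  set n := p ^ (m + b) with hn
  have hn0 : n ≠ 0 := pow_ne_zero _ hp.ne_zero
  set Z := Z0 * fB B with hZ
  have hZc : IsCl Z := hc.mul (fB_isCl hB.1)
  have hZo : IsO v Z := ho.mul hv (fB_isO hv hvp hB)
  have hlam : ∀ χ ∈ B, lam χ Z = lam χ Z0 := by
    intro χ hχ
    rw [hZ, lam_mul (hB.1 χ hχ) hc, lam_fB hB.1 hχ, mul_one]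
  have hZn : Z ^ n = ∑ χ ∈ B, (lam χ Z0) ^ n • eid χ := by
    obtain ⟨k, hk⟩ : ∃ k, n = k + 1 := Nat.exists_eq_succ_of_ne_zero hn0
    have h1 : Z ^ k * Z = ∑ χ ∈ B, Z ^ k * Z0 * eid χ := by
      rw [← Finset.mul_sum, mul_assoc, ← fB]
    rw [hk, pow_succ, h1]
    apply Finset.sum_congr rfl
    intro χ hχ
    rw [mul_eid (hB.1 χ hχ) ((hZc.pow k).mul hc), lam_mul (hB.1 χ hχ) (hZc.pow k),
      lam_pow (hB.1 χ hχ) hZc, hlam χ hχ, pow_succ]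
  have hu : ∀ g, v ((MonoidAlgebra.single x (1:ℂ) * Z).coeff g) ≤ 1 := by
    intro g
    rw [MonoidAlgebra.coeff_single_mul_apply, one_mul]
    exact hZo _
  have key := trace_est hv hp hp1 _ hu y hy b m hb
  rw [← hn, (hZc.comm_single x).mul_pow, MonoidAlgebra.single_pow, one_pow, hx, hZn] at key
  convert key using 2
  simp only [MonoidAlgebra.coeff_single_mul_apply, one_mul, MonoidAlgebra.coeff_sum,
    Finsupp.coe_finsetSum, Finset.sum_apply, MonoidAlgebra.coeff_smul_apply, smul_eq_mul, eid,
    maOf_coeff]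
  rw [Finset.sum_comm]
  apply Finset.sum_congr rfl
  intro χ hχ
  have h1 := irr_conj (hB.1 χ hχ) y⁻¹ x
  have hcard : (Fintype.card G : ℂ) ≠ 0 := by simp
  have h2 := irr_ne (hB.1 χ hχ)
  rw [← Finset.mul_sum, ← Finset.mul_sum]
  congr 1
  have h3 : ∑ t, χ (x⁻¹ * (t * y * t⁻¹))⁻¹ = ∑ t, χ (t * y⁻¹ * t⁻¹ * x) := by
    apply Finset.sum_congr rfl
    intro t _
    congr 1
    group
  rw [h3, h1]
  field_simp

/-- two characters are linked -/
def Lk (v : AbsoluteValue ℂ ℝ) (χ ψ : G → ℂ) : Prop :=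
  ∀ z : MonoidAlgebra ℂ G, IsCl z → IsO v z → v (lam χ z - lam ψ z) < 1

lemma exists_Z0 (hv : IsNonarchimedean v) {χ0 : G → ℂ} (h0 : IsIrrChar G χ0)
    (D : Finset (G → ℂ)) (hD : ∀ ψ ∈ D, IsIrrChar G ψ) (hL : ∀ ψ ∈ D, ¬ Lk v χ0 ψ) :
    ∃ Z : MonoidAlgebra ℂ G, IsCl Z ∧ IsO v Z ∧ lam χ0 Z = 1 ∧ ∀ ψ ∈ D, lam ψ Z = 0 := by
  classical
  induction D using Finset.induction_on with
  | empty => exact ⟨1, IsCl.one, IsO.one, lam_one h0, by simp⟩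
  | insert ψ D hψ ih =>
    obtain ⟨Z, hc, ho, h1, h2⟩ := ih (fun φ hφ => hD φ (mem_insert_of_mem hφ))
      (fun φ hφ => hL φ (mem_insert_of_mem hφ))
    have hi := hD ψ (mem_insert_self _ _)
    have := hL ψ (mem_insert_self _ _)
    unfold Lk at this
    push Not at this
    obtain ⟨z, zc, zo, hz⟩ := this
    have hne : lam χ0 z - lam ψ z ≠ 0 := by
      intro h; rw [h, map_zero] at hz; linarith
    have c1 : IsCl ((lam χ0 z - lam ψ z)⁻¹ • (z - lam ψ z • 1)) :=
      (zc.sub (IsCl.one.smul _)).smul _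
    refine ⟨((lam χ0 z - lam ψ z)⁻¹ • (z - lam ψ z • 1)) * Z, c1.mul hc, ?_, ?_, ?_⟩
    · refine IsO.mul hv (IsO.smul ?_ (zo.sub hv (IsO.smul (lam_le hv hi zc zo) IsO.one))) ho
      rw [map_inv₀]
      exact inv_le_one_of_one_le₀ hz
    · rw [lam_mul h0 c1, h1, lam_smul, lam_sub, lam_smul, lam_one h0, mul_one, mul_one,
        inv_mul_cancel₀ hne]
    · intro φ hφ
      rw [lam_mul (hD φ hφ) c1]
      rcases mem_insert.mp hφ with rfl | hφ
      · rw [lam_smul, lam_sub, lam_smul, lam_one hi]; ring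
      · rw [h2 φ hφ, mul_zero]

lemma linked (hv : IsNonarchimedean v) {p : ℕ} [Fact p.Prime]
    (hvp : ∀ q : ℚ, v (q : ℂ) = (padicNorm p q : ℝ)) {B : Finset (G → ℂ)}
    (hB : IsBlock p G B) {χ0 ψ : G → ℂ} (h0 : χ0 ∈ B) (hψ : ψ ∈ B) : Lk v χ0 ψ := by
  classical
  have hp : p.Prime := Fact.out
  have hvp1 : v (p : ℂ) < 1 := by
    have := hvp p
    rw [Rat.cast_natCast] at this
    rw [this]
    exact_mod_cast padicNorm.padicNorm_p_lt_one_of_prime (p := p)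
  obtain ⟨b, hb⟩ := exists_b (G := G) p
  set C := B.filter (fun ψ => Lk v χ0 ψ) with hC
  have hCB : C ⊆ B := filter_subset _ _
  suffices hu : IsBlockUnion p G C by
    rcases hB.2.2 C hCB hu with h | h
    · exfalso
      have : χ0 ∈ C := by
        rw [hC, mem_filter]
        exact ⟨h0, fun z _ _ => by simp⟩
      rw [h] at this; simp at this
    · rw [← h, hC, mem_filter] at hψ
      exact hψ.2
  refine ⟨fun χ hχ => hB.1.1 χ (hCB hχ), fun x h hx hh => ?_⟩
  obtain ⟨Z, Zc, Zo, Z1, Z2⟩ := exists_Z0 hv (hB.1.1 χ0 h0) (B \ C)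
    (fun φ hφ => hB.1.1 φ (mem_sdiff.mp hφ).1) (fun φ hφ hl => (mem_sdiff.mp hφ).2
      (by rw [hC, mem_filter]; exact ⟨(mem_sdiff.mp hφ).1, hl⟩))
  by_contra hne
  have hpos : 0 < v (∑ χ ∈ C, χ x * χ h) := v.pos hne
  set ε := v (∑ χ ∈ C, χ x * χ h) / 2 with hε
  have hε0 : 0 < ε := half_pos hpos
  have ev1 : ∀ᶠ m : ℕ in Filter.atTop, v (p : ℂ) ^ m < ε :=
    (tendsto_pow_atTop_nhds_zero_of_lt_one (v.nonneg _) hvp1).eventually (gt_mem_nhds hε0)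
  have ev2 : ∀ᶠ k : ℕ in Filter.atTop, ∀ χ ∈ C, v (lam χ Z ^ (p ^ k) - 1) < ε := by
    rw [Filter.eventually_all_finset]
    intro χ hχ
    have hl : Lk v χ0 χ := (mem_filter.mp hχ).2
    have h1 := hl Z Zc Zo
    rw [Z1, v.map_sub] at h1
    obtain ⟨c, c0, c1, hc⟩ := v_pow_tendsto hv p hvp1 h1
    filter_upwards [(tendsto_pow_atTop_nhds_zero_of_lt_one c0 c1).eventually (gt_mem_nhds hε0)]
      with k hk using (hc k).trans_lt hk
  obtain ⟨N1, hN1⟩ := Filter.eventually_atTop.mp ev1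
  obtain ⟨N2, hN2⟩ := Filter.eventually_atTop.mp ev2
  obtain ⟨m, hm, hmx⟩ := exists_m p b x hx (N1 + N2)
  have e1 := block_est hv hvp hB.1 Zc Zo hvp1.le (x := x) (y := h⁻¹) (by rwa [pReg_inv]) hb hmx
  rw [inv_inv] at e1
  have e2 : ∑ χ ∈ B, lam χ Z ^ (p ^ (m + b)) * (χ x * χ h) =
      ∑ χ ∈ C, lam χ Z ^ (p ^ (m + b)) * (χ x * χ h) := by
    symm
    apply Finset.sum_subset hCB
    intro χ h1 h2
    rw [Z2 χ (mem_sdiff.mpr ⟨h1, h2⟩), zero_pow (pow_ne_zero _ hp.ne_zero), zero_mul]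
  rw [e2] at e1
  have e3 : v (∑ χ ∈ C, (lam χ Z ^ (p ^ (m + b)) - 1) * (χ x * χ h)) ≤ ε := by
    apply vsum_le hv _ _ _ hε0.le
    intro χ hχ
    rw [map_mul]
    have i1 := hB.1.1 χ (hCB hχ)
    have := vint_le hv ((irr_int i1 x).mul (irr_int i1 h))
    calc _ ≤ ε * 1 := mul_le_mul (hN2 _ (by omega) χ hχ).le this (v.nonneg _) hε0.le
      _ = ε := mul_one _
  have e4 : ∑ χ ∈ C, χ x * χ h = ∑ χ ∈ C, lam χ Z ^ (p ^ (m + b)) * (χ x * χ h) -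
      ∑ χ ∈ C, (lam χ Z ^ (p ^ (m + b)) - 1) * (χ x * χ h) := by
    rw [← Finset.sum_sub_distrib]
    apply Finset.sum_congr rfl
    intro χ _; ring
  have e5 := vsub_le hv (∑ χ ∈ C, lam χ Z ^ (p ^ (m + b)) * (χ x * χ h))
      (∑ χ ∈ C, (lam χ Z ^ (p ^ (m + b)) - 1) * (χ x * χ h))
  rw [← e4] at e5
  have e6 := e5.trans (max_le (e1.trans (hN1 m (by omega)).le) e3)
  linarith
end link2

section final
variable {v : AbsoluteValue ℂ ℝ} {G H : Type} [Group G] [Fintype G] [Group H] [Fintype H]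

lemma ppart_congr {p : ℕ} [Fact p.Prime] {m n : ℤ} (hm : m ≠ 0) (hn : n ≠ 0)
    (h1 : padicNorm p (m : ℚ) = padicNorm p (n : ℚ))
    (h2 : padicNorm p ((m : ℚ) - n) < padicNorm p (n : ℚ)) :
    (p : ℤ) ∣ pPrimePart p m - pPrimePart p n := by
  have hp : p.Prime := Fact.out
  have hf : ∀ k : ℤ, k ≠ 0 → padicNorm p (k : ℚ) = (p : ℚ) ^ (-(k.natAbs.factorization p : ℤ)) := by
    intro k hk
    rw [padicNorm.eq_zpow_of_nonzero (by exact_mod_cast hk), padicValRat.of_int,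
      padicValInt, Nat.factorization_def _ hp]
  have hdec : ∀ k : ℤ, k = pPrimePart p k * (p : ℤ) ^ (k.natAbs.factorization p) := by
    intro k
    unfold pPrimePart
    rw [Int.ediv_mul_cancel]
    rw [← Int.dvd_natAbs]
    exact_mod_cast Nat.ordProj_dvd _ _
  have hp1 : (1 : ℚ) < p := by exact_mod_cast hp.one_lt
  have he : m.natAbs.factorization p = n.natAbs.factorization p := by
    rw [hf m hm, hf n hn] at h1
    have := zpow_right_injective₀ (by linarith) hp1.ne' h1
    simpa using this
  have hdm := hdec m
  have hdn := hdec n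
  rw [he] at hdm
  set e := n.natAbs.factorization p
  have h3 : ((m : ℚ) - n) = ((pPrimePart p m - pPrimePart p n : ℤ) : ℚ) * (p : ℚ) ^ e := by
    have : (m - n : ℤ) = (pPrimePart p m - pPrimePart p n) * (p : ℤ) ^ e := by
      rw [sub_mul, ← hdm, ← hdn]
    exact_mod_cast this
  have hppow : padicNorm p ((p : ℚ) ^ e) = (p : ℚ) ^ (-(e : ℤ)) := by
    rw [padicNorm.eq_zpow_of_nonzero (pow_ne_zero _ (by exact_mod_cast hp.ne_zero)), padicValRat.pow,
      padicValRat.self hp.one_lt, mul_one]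
  rw [h3, hf n hn, padicNorm.mul, hppow] at h2
  have hpe : (0 : ℚ) < (p : ℚ) ^ (-(e : ℤ)) := zpow_pos (by linarith) _
  have h4 : padicNorm p ((pPrimePart p m - pPrimePart p n : ℤ) : ℚ) < 1 := by
    by_contra hcon
    push Not at hcon
    have := le_mul_of_one_le_left hpe.le hcon
    exact absurd h2 (not_lt.mpr this)
  exact (padicNorm.int_lt_one_iff _).mp h4

lemma sign_of_norm_one {B' : Finset (H → ℂ)} (hB' : ∀ χ ∈ B', IsIrrChar H χ) {x : H → ℂ}
    (hx : x ∈ ZIrr B') (h1 : innerChar H x x = 1) :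
    ∃ χ ∈ B', x = χ ∨ x = -χ := by
  classical
  unfold ZIrr at hx
  rw [Submodule.mem_span_finset] at hx
  obtain ⟨a, -, rfl⟩ := hx
  have hc : (Fintype.card H : ℂ) ≠ 0 := by simp
  have e : innerChar H (∑ φ ∈ B', a φ • φ) (∑ φ ∈ B', a φ • φ) = ((∑ φ ∈ B', a φ ^ 2 : ℤ) : ℂ) := by
    unfold innerChar
    have hsm : ∀ (φ : H → ℂ) (g : H), (a φ • φ) g = (a φ : ℂ) * φ g := fun φ g => by
      rw [Pi.smul_apply, zsmul_eq_mul]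
    rw [inv_mul_eq_iff_eq_mul₀ hc]
    simp only [Finset.sum_apply, hsm, Finset.sum_mul_sum]
    rw [Finset.sum_comm]
    push_cast
    rw [Finset.mul_sum]
    apply Finset.sum_congr rfl
    intro φ hφ
    rw [Finset.sum_comm]
    rw [Finset.sum_eq_single φ]
    · have := irr_orth (hB' φ hφ) (hB' φ hφ)
      rw [if_pos rfl] at this
      rw [← this, Finset.sum_mul]
      apply Finset.sum_congr rfl
      intro g _; ring
    · intro ψ hψ hne
      have := irr_orth (hB' φ hφ) (hB' ψ hψ)
      rw [if_neg hne.symm] at this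
      rw [← mul_zero ((a φ : ℂ) * a ψ), ← this, Finset.mul_sum]
      apply Finset.sum_congr rfl
      intro g _; ring
    · intro h; exact absurd hφ h
  rw [e] at h1
  have h2 : ∑ φ ∈ B', a φ ^ 2 = 1 := by exact_mod_cast h1
  obtain ⟨φ, hφ, hne⟩ : ∃ φ ∈ B', a φ ≠ 0 := by
    by_contra! hcon
    rw [Finset.sum_eq_zero (fun φ hφ => by rw [hcon φ hφ]; rfl)] at h2
    exact zero_ne_one h2
  have h3 := Finset.add_sum_erase B' (fun φ => a φ ^ 2) hφ
  have h4 : 1 ≤ a φ ^ 2 := by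
    have : 0 < a φ ^ 2 := by positivity
    omega
  have h5 : ∑ φ ∈ B'.erase φ, a φ ^ 2 = 0 := by
    have : 0 ≤ ∑ φ ∈ B'.erase φ, a φ ^ 2 := Finset.sum_nonneg (fun _ _ => sq_nonneg _)
    omega
  have h6 : a φ ^ 2 = 1 := by omega
  have h7 : ∀ ψ ∈ B'.erase φ, a ψ = 0 := by
    intro ψ hψ
    exact pow_eq_zero_iff (two_ne_zero) |>.mp ((Finset.sum_eq_zero_iff_of_nonneg (fun _ _ => sq_nonneg _)).mp h5 ψ hψ)
  refine ⟨φ, hφ, ?_⟩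
  rw [← Finset.add_sum_erase B' _ hφ, Finset.sum_eq_zero (fun ψ hψ => by rw [h7 ψ hψ, zero_smul]), add_zero]
  rcases (mul_self_eq_one_iff.mp (by rwa [← sq]) : a φ = 1 ∨ a φ = -1) with h | h
  · left; rw [h, one_smul]
  · right; rw [h, neg_smul, one_smul]

lemma lam_neg (χ : G → ℂ) (z : MonoidAlgebra ℂ G) : lam (-χ) z = lam χ z := by
  simp [lam]

lemma v_div_card {p : ℕ} [Fact p.Prime] (hv : IsNonarchimedean v)
    (hvp : ∀ q : ℚ, v (q : ℂ) = (padicNorm p q : ℝ)) {c : ℂ}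
    (h : IsIntegral ℤ (c / (centOrderP p (1 : G) : ℂ))) : v (c / (Fintype.card G : ℂ)) ≤ 1 := by
  have e : centOrderP p (1 : G) = pPart p (Fintype.card G) := by
    unfold centOrderP
    have : Subgroup.centralizer ({1} : Set G) = ⊤ := by
      ext g; simp [Subgroup.mem_centralizer_iff]
    rw [this, Subgroup.card_top, Nat.card_eq_fintype_card]
  have := vint_le hv h
  rw [e, map_div₀] at this
  rw [map_div₀, v_card hvp Fintype.card_ne_zero]
  exact this

lemma main_delta {p : ℕ} [Fact p.Prime] (hv : IsNonarchimedean v)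
    (hvp : ∀ q : ℚ, v (q : ℂ) = (padicNorm p q : ℝ))
    {B : Finset (G → ℂ)} {B' : Finset (H → ℂ)}
    (hB : IsBlock p G B) (hB' : ∀ χ ∈ B', IsIrrChar H χ)
    (I : ZIrr B ≃ₗ[ℤ] ZIrr B') (hI : IsPerfIso p B B' I)
    (hs : ∀ χ (hχ : χ ∈ B), ∃ χ' ∈ B', ((I (elt χ hχ) : ZIrr B') : H → ℂ) = χ' ∨
      ((I (elt χ hχ) : ZIrr B') : H → ℂ) = -χ')
    {d : B → ℂ} (hd : ∀ χ : B, d χ = (Fintype.card G : ℂ) * ((I (elt χ.1 χ.2) : ZIrr B') : H → ℂ) 1 /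
      ((Fintype.card H : ℂ) * χ.1 1)) (χ ψ : B) :
    v (d χ - d ψ) < 1 ∧ v (d χ) ≤ 1 ∧ v ((d χ)⁻¹) ≤ 1 := by
  classical
  have hcG : (Fintype.card G : ℂ) ≠ 0 := by simp
  have hcH : (Fintype.card H : ℂ) ≠ 0 := by simp
  have hirr : ∀ χ : B, IsIrrChar G χ.1 := fun χ => hB.1.1 χ.1 χ.2
  have hJc : ∀ (χ : B) (a b : H), ((I (elt χ.1 χ.2) : ZIrr B') : H → ℂ) (a * b) =
      ((I (elt χ.1 χ.2) : ZIrr B') : H → ℂ) (b * a) := by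
    intro χ a b
    obtain ⟨χ', h', h | h⟩ := hs χ.1 χ.2
    · rw [h, irr_comm (hB' _ h')]
    · rw [h, Pi.neg_apply, Pi.neg_apply, irr_comm (hB' _ h')]
  let w : MonoidAlgebra ℂ G := maOf fun g => muI I.toLinearMap g⁻¹ (1 : H) / (Fintype.card H : ℂ)
  let z : MonoidAlgebra ℂ H := maOf fun h => muI I.toLinearMap (1 : G) h⁻¹ / (Fintype.card G : ℂ)
  have wo : IsO v w := fun g => v_div_card hv hvp (hI.2.2 _ _).2
  have zo : IsO v z := fun g => v_div_card hv hvp (hI.2.2 _ _).1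
  have wc : IsCl w := by
    intro t g
    simp only [w, maOf_coeff, muI]
    congr 1
    apply Finset.sum_congr rfl
    intro χ _
    rw [show (t * g * t⁻¹)⁻¹ = t * (g⁻¹ * t⁻¹) by group, irr_comm (hirr χ), inv_mul_cancel_right]
  have zc : IsCl z := by
    intro t g
    simp only [z, maOf_coeff, muI]
    congr 1
    apply Finset.sum_congr rfl
    intro χ _
    congr 1
    rw [show (t * g * t⁻¹)⁻¹ = t * (g⁻¹ * t⁻¹) by group]
    simp only [LinearEquiv.coe_coe]
    rw [hJc, inv_mul_cancel_right]
  have hw : ∀ χ : B, lam χ.1 w = d χ := by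
    intro χ
    have h0 := irr_ne (hirr χ)
    have : ∑ g, w.coeff g * χ.1 g = (Fintype.card G : ℂ) * ((I (elt χ.1 χ.2) : ZIrr B') : H → ℂ) 1 /
        (Fintype.card H : ℂ) := by
      simp only [w, maOf_coeff, muI, Finset.sum_div, Finset.sum_mul]
      rw [Finset.sum_comm, Finset.sum_eq_single χ]
      · have := irr_orth (hirr χ) (hirr χ)
        rw [if_pos rfl] at this
        rw [← this, Finset.sum_mul, Finset.sum_div]
        apply Finset.sum_congr rfl
        intro g _
        simp only [LinearEquiv.coe_coe]
        ring
      · intro φ _ hne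
        have := irr_orth (hirr χ) (hirr φ)
        rw [if_neg (fun h => hne (Subtype.ext h.symm))] at this
        rw [← mul_zero (((I (elt φ.1 φ.2) : ZIrr B') : H → ℂ) 1 / (Fintype.card H : ℂ)), ← this,
          Finset.mul_sum]
        apply Finset.sum_congr rfl
        intro g _
        simp only [LinearEquiv.coe_coe]
        ring
      · simp
    rw [lam, this, hd, div_div]
  have hz : ∀ χ : B, lam ((I (elt χ.1 χ.2) : ZIrr B') : H → ℂ) z = (d χ)⁻¹ := by
    intro χ
    have horth : ∀ φ : B, ∑ h, ((I (elt χ.1 χ.2) : ZIrr B') : H → ℂ) h *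
        ((I (elt φ.1 φ.2) : ZIrr B') : H → ℂ) h⁻¹ = if χ = φ then (Fintype.card H : ℂ) else 0 := by
      intro φ
      have h1 := hI.1 (elt χ.1 χ.2) (elt φ.1 φ.2)
      unfold innerChar at h1
      have h2 := irr_orth (hirr χ) (hirr φ)
      have h3 : (elt χ.1 χ.2 : ZIrr B).1 = χ.1 := rfl
      have h4 : (elt φ.1 φ.2 : ZIrr B).1 = φ.1 := rfl
      rw [h3, h4, h2, inv_mul_eq_iff_eq_mul₀ hcH] at h1
      rw [h1]
      by_cases h : χ = φ
      · rw [if_pos h, if_pos (by rw [h]), inv_mul_cancel₀ hcG, mul_one]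
      · rw [if_neg h, if_neg (fun h' => h (Subtype.ext h')), mul_zero, mul_zero]
    have : ∑ g, z.coeff g * ((I (elt χ.1 χ.2) : ZIrr B') : H → ℂ) g =
        (Fintype.card H : ℂ) * χ.1 1 / (Fintype.card G : ℂ) := by
      simp only [z, maOf_coeff, muI, Finset.sum_div, Finset.sum_mul]
      rw [Finset.sum_comm, Finset.sum_eq_single χ]
      · have := horth χ
        rw [if_pos rfl] at this
        rw [← this, Finset.sum_mul, Finset.sum_div]
        apply Finset.sum_congr rfl
        intro g _
        simp only [LinearEquiv.coe_coe]
        ring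
      · intro φ _ hne
        have := horth φ
        rw [if_neg hne.symm] at this
        rw [← mul_zero (φ.1 1 / (Fintype.card G : ℂ)), ← this, Finset.mul_sum]
        apply Finset.sum_congr rfl
        intro g _
        simp only [LinearEquiv.coe_coe]
        ring
      · simp
    rw [lam, this, hd, div_div, inv_div]
  refine ⟨?_, ?_, ?_⟩
  · rw [← hw, ← hw]
    exact linked hv hvp hB χ.2 ψ.2 w wc wo
  · rw [← hw]
    exact lam_le hv (hirr χ) wc wo
  · rw [← hz]
    obtain ⟨χ', h', h | h⟩ := hs χ.1 χ.2
    · rw [h]; exact lam_le hv (hB' _ h') zc zo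
    · rw [h, lam_neg]; exact lam_le hv (hB' _ h') zc zo
end final

/-- **Broué.** If `I` is a perfect isometry between `B` and `B'`, then
`(I(χ)(1)·ψ(1))_{p'} ≡ (I(ψ)(1)·χ(1))_{p'} (mod p)` for all `χ, ψ ∈ Irr(B)`. -/
theorem perfect_isometry_degree_congruence (p : ℕ) [Fact p.Prime]
    (G H : Type) [Group G] [Fintype G] [Group H] [Fintype H]
    (B : Finset (G → ℂ)) (B' : Finset (H → ℂ))
    (hB : IsBlock p G B) (hB' : IsBlock p H B')
    (I : ZIrr B ≃ₗ[ℤ] ZIrr B') (hI : IsPerfIso p B B' I) :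
    ∀ χ ψ (hχ : χ ∈ B) (hψ : ψ ∈ B), ∃ m n : ℤ,
      ((I (elt χ hχ) : ZIrr B') : H → ℂ) 1 * ψ 1 = (m : ℂ) ∧
      ((I (elt ψ hψ) : ZIrr B') : H → ℂ) 1 * χ 1 = (n : ℂ) ∧
      (p : ℤ) ∣ pPrimePart p m - pPrimePart p n := by
  classical
  obtain ⟨v, hv, hvp⟩ := exists_absval p
  have hcG : (Fintype.card G : ℂ) ≠ 0 := by simp
  have hcH : (Fintype.card H : ℂ) ≠ 0 := by simp
  have hs : ∀ χ (hχ : χ ∈ B), ∃ χ' ∈ B', ((I (elt χ hχ) : ZIrr B') : H → ℂ) = χ' ∨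
      ((I (elt χ hχ) : ZIrr B') : H → ℂ) = -χ' := by
    intro χ hχ
    apply sign_of_norm_one hB'.1.1 (I (elt χ hχ)).2
    rw [hI.1]
    have h3 : (elt χ hχ : ZIrr B).1 = χ := rfl
    have h2 := irr_orth (hB.1.1 χ hχ) (hB.1.1 χ hχ)
    rw [if_pos rfl] at h2
    rw [h3, innerChar, h2, inv_mul_cancel₀ hcG]
  have hJ1 : ∀ χ (hχ : χ ∈ B), ∃ k : ℤ, k ≠ 0 ∧ ((I (elt χ hχ) : ZIrr B') : H → ℂ) 1 = k := by
    intro χ hχ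
    obtain ⟨χ', h', h⟩ := hs χ hχ
    obtain ⟨n, hn, e⟩ := irr_one (hB'.1.1 χ' h')
    rcases h with h | h
    · exact ⟨n, by exact_mod_cast hn, by rw [h, e]; simp⟩
    · exact ⟨-n, by simpa using hn, by rw [h, Pi.neg_apply, e]; simp⟩
  intro χ ψ hχ hψ
  let d : B → ℂ := fun χ => (Fintype.card G : ℂ) * ((I (elt χ.1 χ.2) : ZIrr B') : H → ℂ) 1 /
      ((Fintype.card H : ℂ) * χ.1 1)
  obtain ⟨a1, a2, a3⟩ := main_delta hv hvp hB hB'.1.1 I hI hs (d := d) (fun _ => rfl) ⟨χ, hχ⟩ ⟨ψ, hψ⟩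
  obtain ⟨-, b2, b3⟩ := main_delta hv hvp hB hB'.1.1 I hI hs (d := d) (fun _ => rfl) ⟨ψ, hψ⟩ ⟨χ, hχ⟩
  obtain ⟨k, k0, hk⟩ := hJ1 χ hχ
  obtain ⟨l, l0, hl⟩ := hJ1 ψ hψ
  obtain ⟨r, r0, hr⟩ := irr_one (hB.1.1 χ hχ)
  obtain ⟨s, s0, hs'⟩ := irr_one (hB.1.1 ψ hψ)
  refine ⟨k * s, l * r, by rw [hk, hs']; push_cast; ring, by rw [hl, hr]; push_cast; ring, ?_⟩
  have ed : d ⟨χ, hχ⟩ = Fintype.card G * k / (Fintype.card H * r) := by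
    simp only [d]; rw [hk, hr]
  have ee : d ⟨ψ, hψ⟩ = Fintype.card G * l / (Fintype.card H * s) := by
    simp only [d]; rw [hl, hs']
  set D := d ⟨χ, hχ⟩
  set E := d ⟨ψ, hψ⟩
  have r0' : (r : ℂ) ≠ 0 := by exact_mod_cast r0
  have s0' : (s : ℂ) ≠ 0 := by exact_mod_cast s0
  have k0' : (k : ℂ) ≠ 0 := by exact_mod_cast k0
  have l0' : (l : ℂ) ≠ 0 := by exact_mod_cast l0
  have hD0 : D ≠ 0 := by
    rw [ed]; exact div_ne_zero (mul_ne_zero hcG k0') (mul_ne_zero hcH r0')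
  have hE0 : E ≠ 0 := by
    rw [ee]; exact div_ne_zero (mul_ne_zero hcG l0') (mul_ne_zero hcH s0')
  have hvone : ∀ x : ℂ, x ≠ 0 → v x ≤ 1 → v x⁻¹ ≤ 1 → v x = 1 := by
    intro x hx h1 h2
    rw [map_inv₀] at h2
    exact le_antisymm h1 ((inv_le_one₀ (v.pos hx)).mp h2)
  have vD := hvone D hD0 a2 a3
  have vE := hvone E hE0 b2 b3
  have hmn : ((k : ℂ) * s) * E = D * (l * r) := by
    rw [ed, ee]; field_simp
  have hmn2 : ((k : ℂ) * s - l * r) * E = (D - E) * (l * r) := by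
    rw [sub_mul, hmn]; ring
  have hV : ∀ q : ℤ, v (q : ℂ) = (padicNorm p (q : ℚ) : ℝ) := by
    intro q
    have := hvp q
    rwa [Rat.cast_intCast] at this
  have n1 : v ((k : ℂ) * s) = v ((l : ℂ) * r) := by
    have := congrArg v hmn
    rwa [map_mul, map_mul v D, vD, vE, mul_one, one_mul] at this
  have n2 : v ((k : ℂ) * s - l * r) < v ((l : ℂ) * r) := by
    have := congrArg v hmn2
    rw [map_mul, map_mul v (D - E), vE, mul_one] at this
    rw [this]
    exact mul_lt_of_lt_one_left (v.pos (mul_ne_zero l0' r0')) a1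
  have c1 : ((k : ℂ) * s) = ((k * s : ℤ) : ℂ) := by push_cast; ring
  have c2 : ((l : ℂ) * r) = ((l * r : ℤ) : ℂ) := by push_cast; ring
  apply ppart_congr (mul_ne_zero k0 (by exact_mod_cast s0)) (mul_ne_zero l0 (by exact_mod_cast r0))
  · rw [c1, c2, hV, hV] at n1
    exact_mod_cast n1
  · rw [c1, c2, ← Int.cast_sub, hV, hV] at n2
    have := (Rat.cast_lt (K := ℝ)).mp n2
    rwa [Int.cast_sub] at this

end
end

section
/- Let G be a finite group with conjugacy class sums K₁⁺,…,Kₙ⁺ and structure constants a_{ijk} defined by Kᵢ⁺Kⱼ⁺ = Σₖ a_{ijk} Kₖ⁺. Then the character table of G is determined up to permutation of rows and columns by the numbers a_{ijk}: the matrices Mᵢ = (a_{ijk})_{j,k} are simultaneously diagonalized by the matrix of central character values, whose columns are determined up to permutation and scalar sign, and the signs are forced. -/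
open scoped BigOperators
open Finset

noncomputable section

/-- The set of irreducible characters of `G`, as a type. -/
def IrrT (G : Type) [Group G] [Fintype G] := {χ : G → ℂ // IsIrrChar G χ}

/-- The class-multiplication structure constant `a_{CD}(z)`: the number of pairs
`(x,y)` with `x ∈ C`, `y ∈ D`, `xy = z` (depending only on the class of `z`). -/
def classConst {G : Type} [Group G] (C D : ConjClasses G) (z : G) : ℕ :=
  Nat.card {q : G × G // ConjClasses.mk q.1 = C ∧ ConjClasses.mk q.2 = D ∧ q.1 * q.2 = z}

/-- Normalised irreducible characters: functional equation. -/
def IsSph (G : Type) [Group G] [Fintype G] (φ : G → ℂ) : Prop :=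
  φ 1 = 1 ∧ ∀ g h, ∑ x : G, φ (g * (x * h * x⁻¹)) = Fintype.card G * φ g * φ h

theorem deg_ne_zero {G : Type} [Group G] [Fintype G] (V : FDRep ℂ G)
    [CategoryTheory.Simple V] : V.character 1 ≠ 0 := by
  intro h0
  have h1 := (FDRep.simple_iff_char_is_norm_one V).1 inferInstance
  rw [FDRep.char_one] at h0
  have h2 : Module.finrank ℂ V = 0 := by exact_mod_cast h0
  have h3 : Subsingleton V := Module.finrank_zero_iff.1 h2
  have h4 : ∀ g, V.character g = 0 := fun g => by
    have : V.ρ g = 0 := by ext v; exact Subsingleton.elim _ _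
    simp [FDRep.character, this]
  simp only [h4, mul_zero, Finset.sum_const_zero] at h1
  exact (Nat.cast_ne_zero.2 (Nat.card_pos (α := G)).ne') h1.symm

theorem schur_scalar {G : Type} [Group G] [Fintype G] (V : FDRep ℂ G)
    [CategoryTheory.Simple V] (T : V →ₗ[ℂ] V) (hT : ∀ g, T ∘ₗ V.ρ g = V.ρ g ∘ₗ T) :
    ∃ c : ℂ, T = c • LinearMap.id := by
  have h1 := (FDRep.simple_iff_end_is_rank_one V).1 inferInstance
  let f : V ⟶ V := FDRep.forget₂HomLinearEquiv V V (Rep.ofHom ⟨T, fun g => hT g⟩)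
  have hne : CategoryTheory.CategoryStruct.id V ≠ 0 := CategoryTheory.id_nonzero V
  obtain ⟨c, hc⟩ := (finrank_eq_one_iff_of_nonzero' _ hne).1 h1 f
  refine ⟨c, ?_⟩
  have := congrArg (fun f : V ⟶ V => f.hom.hom.hom) hc
  exact this.symm

theorem sph_of_simple {G : Type} [Group G] [Fintype G] (V : FDRep ℂ G)
    [CategoryTheory.Simple V] : IsSph G (fun g => V.character g / V.character 1) := by
  have hd := deg_ne_zero V
  refine ⟨div_self hd, fun g h => ?_⟩
  let T : V →ₗ[ℂ] V := ∑ x : G, V.ρ (x * h * x⁻¹)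
  obtain ⟨c, hc⟩ := schur_scalar V T (by
    intro g
    change T * V.ρ g = V.ρ g * T
    simp only [T, Finset.sum_mul, Finset.mul_sum, ← map_mul]
    refine (Fintype.sum_equiv (Equiv.mulLeft g) _ _ ?_).symm
    intro x
    congr 1
    simp [mul_assoc])
  have key : ∀ g, ∑ x : G, V.character (g * (x * h * x⁻¹)) = c * V.character g := by
    intro g
    have : ∑ x : G, V.character (g * (x * h * x⁻¹)) = LinearMap.trace ℂ V (V.ρ g * T) := by
      simp only [T, Finset.mul_sum, map_sum, ← map_mul]
      rfl
    rw [this, hc]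
    have : V.ρ g * (c • LinearMap.id) = c • V.ρ g := by ext v; simp
    rw [this]
    simp [FDRep.character]
  have k1 := key 1
  have kg := key g
  simp only [one_mul, FDRep.char_conj, Finset.sum_const, Finset.card_univ, nsmul_eq_mul] at k1
  rw [← Finset.sum_div, kg]
  field_simp
  linear_combination (-V.character g) * k1

theorem exists_of_simple_module {G : Type} [Group G] [Fintype G] (φ : G → ℂ)
    (M : Type) [AddCommGroup M] [Module ℂ M] [Module (MonoidAlgebra ℂ G) M]
    [IsScalarTower ℂ (MonoidAlgebra ℂ G) M] [Module.Finite (MonoidAlgebra ℂ G) M] [IsSimpleModule (MonoidAlgebra ℂ G) M]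
    (hM : ∀ (h : G) (m : M), (∑ x : G, MonoidAlgebra.single (x * h * x⁻¹) (1 : ℂ)) • m =
      (algebraMap ℂ (MonoidAlgebra ℂ G) (Fintype.card G * φ h)) • m) :
    ∃ V : FDRep ℂ G, CategoryTheory.Simple V ∧ ∀ g, V.character g = V.character 1 * φ g := by
  let ρ : Representation ℂ G M := Representation.ofModule' M
  have hρ : ∀ (r : MonoidAlgebra ℂ G) (m : M), ρ.asAlgebraHom r m = r • m := by
    intro r m
    have : ρ.asAlgebraHom = Algebra.lsmul ℂ ℂ M := by
      simp [Representation.asAlgebraHom, ρ, Representation.ofModule']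
    rw [this]; rfl
  have hirr : ρ.IsIrreducible := by
    rw [Representation.irreducible_iff_isSimpleModule_asModule]
    let e : ρ.asModule ≃ₗ[MonoidAlgebra ℂ G] M :=
      { ρ.asModuleEquiv.toAddEquiv with map_smul' := fun r m => hρ r m }
    exact IsSimpleModule.congr e
  have : Module.Finite ℂ M := Module.Finite.trans (MonoidAlgebra ℂ G) _
  have hcard : (Nat.card G : ℂ) ≠ 0 := Nat.cast_ne_zero.2 (Nat.card_pos (α := G)).ne'
  refine ⟨FDRep.of ρ, ?_, ?_⟩
  · rw [FDRep.simple_iff_char_is_norm_one]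
    have := invertibleOfNonzero hcard
    have h := Representation.char_orthonormal ρ ρ
    rw [if_pos ⟨Representation.Equiv.refl ρ⟩] at h
    rw [inv_mul_eq_iff_eq_mul₀ hcard] at h
    rw [mul_one] at h
    exact h
  · intro g
    have key : ∑ x : G, ρ (x * g * x⁻¹) = (Fintype.card G * φ g : ℂ) • LinearMap.id := by
      ext m
      have h1 := hρ (∑ x : G, MonoidAlgebra.single (x * g * x⁻¹) (1 : ℂ)) m
      rw [hM, algebraMap_smul] at h1
      simp only [map_sum, Representation.asAlgebraHom_single, one_smul] at h1
      exact h1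
    have h2 := congrArg (LinearMap.trace ℂ _) key
    rw [map_sum] at h2
    have h3 : ∀ x, LinearMap.trace ℂ _ (ρ (x * g * x⁻¹)) = (FDRep.of ρ).character g := fun x =>
      FDRep.char_conj (FDRep.of ρ) g x
    have h4 : LinearMap.trace ℂ M LinearMap.id
        = (FDRep.of ρ).character 1 := by
      rw [FDRep.char_one, LinearMap.trace_id]
    simp only [h3, map_smul, h4, Finset.sum_const, Finset.card_univ, nsmul_eq_mul,
      smul_eq_mul] at h2
    rw [Nat.card_eq_fintype_card] at hcard
    apply mul_left_cancel₀ hcard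
    rw [h2]; ring

theorem exists_of_sph {G : Type} [Group G] [Fintype G] (φ : G → ℂ) (hφ : IsSph G φ) :
    ∃ V : FDRep ℂ G, CategoryTheory.Simple V ∧ ∀ g, V.character g = V.character 1 * φ g := by
  classical
  let T : G → MonoidAlgebra ℂ G := fun h => ∑ x : G, MonoidAlgebra.single (x * h * x⁻¹) 1
  have hTs : ∀ h g, Commute (T h) (MonoidAlgebra.single g 1) := by
    intro h g
    simp only [T, Commute, SemiconjBy, Finset.sum_mul, Finset.mul_sum,
      MonoidAlgebra.single_mul_single]
    refine (Fintype.sum_equiv (Equiv.mulLeft g) _ _ ?_).symm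
    intro x
    simp [mul_assoc]
  have hT : ∀ h a, Commute (T h) a := by
    intro h a
    induction a using MonoidAlgebra.induction_on with
    | of g => exact hTs h g
    | add a b ha hb => exact ha.add_right hb
    | smul r a ha => exact ha.smul_right r
  let L : MonoidAlgebra ℂ G →ₗ[ℂ] ℂ :=
    Finsupp.linearCombination ℂ φ ∘ₗ (MonoidAlgebra.coeffLinearEquiv ℂ).toLinearMap
  have hL : ∀ g c, L (MonoidAlgebra.single g c) = c * φ g := by
    intro g c
    change Finsupp.linearCombination ℂ φ (Finsupp.single g c) = _
    simp
  let S : G → MonoidAlgebra ℂ G :=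
    fun h => T h - algebraMap ℂ (MonoidAlgebra ℂ G) (Fintype.card G * φ h)
  have hS : ∀ a h, L (a * S h) = 0 := by
    intro a h
    induction a using MonoidAlgebra.induction_on with
    | of g =>
      have h2 := hφ.2 g h
      simp only [S, T, mul_sub, map_sub, Finset.mul_sum, MonoidAlgebra.of_apply,
        MonoidAlgebra.single_mul_single, map_sum, hL, ← Algebra.commutes, ← Algebra.smul_def,
        map_smul, one_mul, smul_eq_mul]
      rw [h2]; ring
    | add a b ha hb => rw [add_mul, map_add, ha, hb, add_zero]
    | smul r a ha => rw [smul_mul_assoc, map_smul, ha, smul_zero]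
  let I : Ideal (MonoidAlgebra ℂ G) := Ideal.span (Set.range S)
  have hI : ∀ a ∈ I, L a = 0 := by
    intro a ha
    have ha' := ha
    rw [show I = Submodule.span _ (Set.range S) from rfl] at ha'
    rw [Finsupp.mem_span_range_iff_exists_finsupp] at ha'
    obtain ⟨c, rfl⟩ := ha'
    rw [Finsupp.sum, map_sum]
    exact Finset.sum_eq_zero fun h _ => hS _ h
  have hI1 : I ≠ ⊤ := by
    intro h
    have := hI 1 (by rw [h]; trivial)
    rw [MonoidAlgebra.one_def, hL, hφ.1] at this
    simp at this
  obtain ⟨J, hJ, hIJ⟩ := Ideal.exists_le_maximal I hI1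
  have : IsSimpleModule (MonoidAlgebra ℂ G) (MonoidAlgebra ℂ G ⧸ J) :=
    isSimpleModule_iff_isCoatom.2 (Ideal.isMaximal_def.1 hJ)
  apply exists_of_simple_module φ (MonoidAlgebra ℂ G ⧸ J)
  intro h m
  obtain ⟨a, rfl⟩ := Submodule.Quotient.mk_surjective J m
  rw [← Submodule.Quotient.mk_smul, ← Submodule.Quotient.mk_smul, Submodule.Quotient.eq]
  have : a * S h ∈ J := hIJ (Ideal.mul_mem_left _ _ (Ideal.subset_span ⟨h, rfl⟩))
  have h2 : (T h) • a - algebraMap ℂ (MonoidAlgebra ℂ G) (Fintype.card G * φ h) • a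
      = a * S h := by
    simp only [S, mul_sub, smul_eq_mul, (hT h a).eq, Algebra.commutes]
  rw [← h2] at this
  exact this

/-- Indicator of a conjugacy class. -/
def clInd {G : Type} [Group G] (C : ConjClasses G) (g : G) : ℂ :=
  open Classical in if ConjClasses.mk g = C then 1 else 0

theorem clInd_def {G : Type} [Group G] [DecidableEq (ConjClasses G)] (C : ConjClasses G) (g : G) :
    clInd C g = if ConjClasses.mk g = C then 1 else 0 := by
  unfold clInd
  split_ifs <;> rfl

theorem mk_conj {G : Type} [Group G] (g x : G) :
    ConjClasses.mk (x * g * x⁻¹) = ConjClasses.mk g :=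
  (ConjClasses.mk_eq_mk_iff_isConj.2 (isConj_iff.2 ⟨x, rfl⟩)).symm

theorem clInd_conj {G : Type} [Group G] (C : ConjClasses G) (g x : G) :
    clInd C (x * g * x⁻¹) = clInd C g := by
  classical
  simp only [clInd_def, mk_conj]

theorem classConst_eq {G : Type} [Group G] [Fintype G] (C D : ConjClasses G) (z : G) :
    (classConst C D z : ℂ) = ∑ g : G, clInd C g * clInd D (g⁻¹ * z) := by
  classical
  have e : {q : G × G // ConjClasses.mk q.1 = C ∧ ConjClasses.mk q.2 = D ∧ q.1 * q.2 = z} ≃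
      {g : G // ConjClasses.mk g = C ∧ ConjClasses.mk (g⁻¹ * z) = D} :=
    { toFun := fun q => ⟨q.1.1, q.2.1, by
        have h := q.2.2.1
        rwa [show q.1.2 = q.1.1⁻¹ * z from eq_inv_mul_of_mul_eq q.2.2.2] at h⟩
      invFun := fun g => ⟨(g.1, g.1⁻¹ * z), g.2.1, g.2.2, by simp⟩
      left_inv := by
        rintro ⟨⟨a, b⟩, h1, h2, rfl⟩
        simp
      right_inv := by
        rintro ⟨g, hg⟩
        rfl }
  rw [classConst, Nat.card_congr e, Nat.card_eq_fintype_card, Fintype.card_subtype,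
    Finset.card_filter]
  push_cast
  refine Finset.sum_congr rfl fun g _ => ?_
  simp only [clInd_def]
  split_ifs <;> simp_all

theorem sum_clInd {G : Type} [Group G] [Fintype G] [Fintype (ConjClasses G)] (y : G) :
    ∑ D : ConjClasses G, clInd D y = 1 := by
  classical
  simp [clInd_def]

theorem sum_classConst {G : Type} [Group G] [Fintype G] (C D : ConjClasses G) (φ : G → ℂ) :
    ∑ z : G, (classConst C D z : ℂ) * φ z =
      ∑ g : G, ∑ h : G, clInd C g * clInd D h * φ (g * h) := by
  simp only [classConst_eq, Finset.sum_mul]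
  rw [Finset.sum_comm]
  refine Finset.sum_congr rfl fun g _ => ?_
  exact Fintype.sum_equiv (Equiv.mulLeft g⁻¹) _ _ (fun x => by simp)

/-- Summing over a conjugation of the second variable does not change the double sum. -/
theorem double_sum_conj {G : Type} [Group G] [Fintype G] (C D : ConjClasses G) (φ : G → ℂ) :
    ∑ g : G, ∑ h : G, clInd C g * clInd D h * ∑ x : G, φ (g * (x * h * x⁻¹)) =
      Fintype.card G * ∑ g : G, ∑ h : G, clInd C g * clInd D h * φ (g * h) := by
  have : ∀ x g : G, ∑ h : G, clInd C g * clInd D h * φ (g * (x * h * x⁻¹)) =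
      ∑ h : G, clInd C g * clInd D h * φ (g * h) := by
    intro x g
    refine Fintype.sum_equiv (MulAut.conj x).toEquiv _ _ (fun h => ?_)
    simp [clInd_conj]
  simp only [Finset.mul_sum]
  have h2 : ∀ g : G, ∑ h : G, ∑ x : G, clInd C g * clInd D h * φ (g * (x * h * x⁻¹)) =
      Fintype.card G * ∑ h : G, clInd C g * clInd D h * φ (g * h) := by
    intro g
    rw [Finset.sum_comm]
    simp only [this, Finset.sum_const, Finset.card_univ, nsmul_eq_mul]
  simp only [h2, Finset.mul_sum]

theorem sph_mul {G : Type} [Group G] [Fintype G] (φ : G → ℂ) (hφ : IsSph G φ)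
    (C D : ConjClasses G) :
    ∑ z : G, (classConst C D z : ℂ) * φ z =
      (∑ g : G, clInd C g * φ g) * (∑ h : G, clInd D h * φ h) := by
  have hcard : (Fintype.card G : ℂ) ≠ 0 := Nat.cast_ne_zero.2 Fintype.card_ne_zero
  apply mul_left_cancel₀ hcard
  rw [sum_classConst, ← double_sum_conj]
  rw [Finset.sum_mul_sum]
  simp only [hφ.2, Finset.mul_sum]
  refine Finset.sum_congr rfl fun g _ => Finset.sum_congr rfl fun h _ => ?_
  ring

theorem sph_of_mul {G : Type} [Group G] [Fintype G] (φ : G → ℂ) (h1 : φ 1 = 1)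
    (hc : ∀ g x, φ (x * g * x⁻¹) = φ g)
    (hm : ∀ C D : ConjClasses G, ∑ z : G, (classConst C D z : ℂ) * φ z =
      (∑ g : G, clInd C g * φ g) * (∑ h : G, clInd D h * φ h)) : IsSph G φ := by
  classical
  refine ⟨h1, fun g h => ?_⟩
  have hcl : ∀ a b : G, ConjClasses.mk a = ConjClasses.mk b → ∃ y, a = y * b * y⁻¹ := by
    intro a b hab
    obtain ⟨y, hy⟩ := isConj_iff.1 (ConjClasses.mk_eq_mk_iff_isConj.1 hab.symm)
    exact ⟨y, hy.symm⟩
  have inv2 : ∀ g h y, ∑ x : G, φ (g * (x * (y * h * y⁻¹) * x⁻¹)) =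
      ∑ x : G, φ (g * (x * h * x⁻¹)) := by
    intro g h y
    refine Fintype.sum_equiv (Equiv.mulRight y) _ _ (fun x => ?_)
    simp [mul_assoc]
  have inv1 : ∀ g h y, ∑ x : G, φ ((y * g * y⁻¹) * (x * h * x⁻¹)) =
      ∑ x : G, φ (g * (x * h * x⁻¹)) := by
    intro g h y
    refine Fintype.sum_equiv (Equiv.mulLeft y⁻¹) _ _ (fun x => ?_)
    rw [← hc (g * _) y]
    congr 1
    simp [mul_assoc]
  have hpos : ∀ C : ConjClasses G, ∀ g, ConjClasses.mk g = C → ∑ a : G, clInd C a ≠ 0 := by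
    intro C g hg
    simp only [clInd_def, Finset.sum_boole]
    exact Nat.cast_ne_zero.2 (Finset.card_ne_zero_of_mem (a := g) (by simp [hg]))
  have hs : ∀ g : G, ∑ a : G, clInd (ConjClasses.mk g) a * φ a =
      (∑ a : G, clInd (ConjClasses.mk g) a) * φ g := by
    intro g
    rw [Finset.sum_mul]
    refine Finset.sum_congr rfl fun a _ => ?_
    by_cases ha : ConjClasses.mk a = ConjClasses.mk g
    · obtain ⟨y, rfl⟩ := hcl _ _ ha
      rw [hc]
    · simp [clInd_def, ha]
  have key := double_sum_conj (ConjClasses.mk g) (ConjClasses.mk h) φ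
  rw [← sum_classConst, hm, hs, hs] at key
  have h3 : ∑ a : G, ∑ b : G, clInd (ConjClasses.mk g) a * clInd (ConjClasses.mk h) b *
      ∑ x : G, φ (a * (x * b * x⁻¹)) =
      (∑ a : G, clInd (ConjClasses.mk g) a) * (∑ b : G, clInd (ConjClasses.mk h) b) *
        ∑ x : G, φ (g * (x * h * x⁻¹)) := by
    rw [Finset.sum_mul_sum, Finset.sum_mul]
    refine Finset.sum_congr rfl fun a _ => ?_
    rw [Finset.sum_mul]
    refine Finset.sum_congr rfl fun b _ => ?_
    by_cases ha : ConjClasses.mk a = ConjClasses.mk g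
    · by_cases hb : ConjClasses.mk b = ConjClasses.mk h
      · obtain ⟨y, rfl⟩ := hcl _ _ ha
        obtain ⟨t, rfl⟩ := hcl _ _ hb
        rw [inv1, inv2]
      · simp [clInd_def, hb]
    · simp [clInd_def, ha]
  rw [h3] at key
  have n1 := hpos _ g rfl
  have n2 := hpos _ h rfl
  apply mul_left_cancel₀ (mul_ne_zero n1 n2)
  rw [key]; ring

/-- The hypothesis on structure constants. -/
def CCMatch {G H : Type} [Group G] [Group H] (σ : ConjClasses G ≃ ConjClasses H) : Prop :=
  ∀ (C D : ConjClasses G) (z : G) (w : H),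
      σ (ConjClasses.mk z) = ConjClasses.mk w →
      classConst C D z = classConst (σ C) (σ D) w

theorem CCMatch.symm {G H : Type} [Group G] [Group H] {σ : ConjClasses G ≃ ConjClasses H}
    (ha : CCMatch σ) : CCMatch σ.symm := by
  intro C D z w h
  rw [ha (σ.symm C) (σ.symm D) w z (by rw [← h]; simp)]
  simp

theorem CCMatch.size {G H : Type} [Group G] [Fintype G] [Group H] [Fintype H]
    {σ : ConjClasses G ≃ ConjClasses H} (ha : CCMatch σ) (C : ConjClasses G) :
    ∑ g : G, clInd C g = ∑ h : H, clInd (σ C) h := by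
  classical
  have gen : ∀ (K : Type) [Group K] [Fintype K] (C : ConjClasses K) (z : K),
      ∑ D : ConjClasses K, (classConst C D z : ℂ) = ∑ g : K, clInd C g := by
    intro K _ _ C z
    simp only [classConst_eq]
    rw [Finset.sum_comm]
    simp only [← Finset.mul_sum, sum_clInd, mul_one]
  obtain ⟨w, hw⟩ := ConjClasses.exists_rep (σ (ConjClasses.mk (1 : G)))
  rw [← gen G C 1, ← gen H (σ C) w]
  exact Fintype.sum_equiv σ _ _ (fun D => by rw [ha C D 1 w hw.symm])

theorem sum_by_class {G : Type} [Group G] [Fintype G] [Fintype (ConjClasses G)]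
    (F : ConjClasses G → ℂ) :
    ∑ g : G, F (ConjClasses.mk g) = ∑ C, (∑ g : G, clInd C g) * F C := by
  classical
  simp only [Finset.sum_mul]
  rw [Finset.sum_comm]
  refine Finset.sum_congr rfl fun g _ => ?_
  simp [clInd_def]

theorem CCMatch.sum {G H : Type} [Group G] [Fintype G] [Group H] [Fintype H]
    {σ : ConjClasses G ≃ ConjClasses H} (ha : CCMatch σ) (F : ConjClasses G → ℂ) :
    ∑ g : G, F (ConjClasses.mk g) = ∑ h : H, F (σ.symm (ConjClasses.mk h)) := by
  classical
  rw [sum_by_class, sum_by_class (fun C => F (σ.symm C))]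
  exact Fintype.sum_equiv σ _ _ (fun D => by rw [ha.size]; simp)

theorem classConst_ne_zero {G : Type} [Group G] [Fintype G] {C D : ConjClasses G} {z : G} :
    classConst C D z ≠ 0 ↔
      ∃ x y, ConjClasses.mk x = C ∧ ConjClasses.mk y = D ∧ x * y = z := by
  rw [classConst, Nat.card_ne_zero]
  constructor
  · rintro ⟨⟨⟨x, y⟩, h⟩, _⟩
    exact ⟨x, y, h⟩
  · rintro ⟨x, y, h⟩
    exact ⟨⟨⟨(x, y), h⟩⟩, inferInstance⟩

theorem mk_eq_one {G : Type} [Group G] {x : G} (h : ConjClasses.mk x = ConjClasses.mk 1) :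
    x = 1 := isConj_one_right.1 (ConjClasses.mk_eq_mk_iff_isConj.1 h.symm)

theorem CCMatch.one {G H : Type} [Group G] [Fintype G] [Group H] [Fintype H]
    {σ : ConjClasses G ≃ ConjClasses H} (ha : CCMatch σ) :
    σ (ConjClasses.mk 1) = ConjClasses.mk 1 := by
  obtain ⟨z, hz⟩ := ConjClasses.exists_rep (σ.symm (ConjClasses.mk 1))
  have hz' : σ (ConjClasses.mk z) = ConjClasses.mk 1 := by rw [hz]; simp
  have h1 : classConst (ConjClasses.mk 1) (ConjClasses.mk z) z ≠ 0 :=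
    classConst_ne_zero.2 ⟨1, z, rfl, rfl, one_mul z⟩
  rw [ha _ _ z 1 hz', hz'] at h1
  obtain ⟨x, y, hx, hy, hxy⟩ := classConst_ne_zero.1 h1
  have hy1 := mk_eq_one hy
  subst hy1
  rw [mul_one] at hxy
  subst hxy
  exact hx.symm

theorem mk_inv {G : Type} [Group G] {x y : G} (h : ConjClasses.mk x = ConjClasses.mk y) :
    ConjClasses.mk x⁻¹ = ConjClasses.mk y⁻¹ := by
  obtain ⟨c, rfl⟩ := isConj_iff.1 (ConjClasses.mk_eq_mk_iff_isConj.1 h)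
  rw [show (c * x * c⁻¹)⁻¹ = c * x⁻¹ * c⁻¹ by group, mk_conj]

theorem CCMatch.inv {G H : Type} [Group G] [Fintype G] [Group H] [Fintype H]
    {σ : ConjClasses G ≃ ConjClasses H} (ha : CCMatch σ) (z : G) (w : H)
    (h : σ (ConjClasses.mk z) = ConjClasses.mk w) :
    σ (ConjClasses.mk z⁻¹) = ConjClasses.mk w⁻¹ := by
  have h1 : classConst (ConjClasses.mk z) (ConjClasses.mk z⁻¹) 1 ≠ 0 :=
    classConst_ne_zero.2 ⟨z, z⁻¹, rfl, rfl, by simp⟩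
  rw [ha _ _ 1 1 ha.one, h] at h1
  obtain ⟨x, y, hx, hy, hxy⟩ := classConst_ne_zero.1 h1
  rw [← hy, ← mk_inv hx, eq_inv_of_mul_eq_one_right hxy]

theorem CCMatch.sph {G H : Type} [Group G] [Fintype G] [Group H] [Fintype H]
    {σ : ConjClasses G ≃ ConjClasses H} (ha : CCMatch σ) (Φ : ConjClasses G → ℂ)
    (hΦ : IsSph G (fun g => Φ (ConjClasses.mk g))) :
    IsSph H (fun h => Φ (σ.symm (ConjClasses.mk h))) := by
  apply sph_of_mul
  · rw [← ha.one]
    simpa using hΦ.1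
  · intro g x
    rw [mk_conj]
  · intro C' D'
    obtain ⟨C, rfl⟩ := σ.surjective C'
    obtain ⟨D, rfl⟩ := σ.surjective D'
    have h := sph_mul _ hΦ C D
    have t : ∀ C : ConjClasses G, ∑ g : G, clInd C g * Φ (ConjClasses.mk g) =
        ∑ h : H, clInd (σ C) h * Φ (σ.symm (ConjClasses.mk h)) := by
      classical
      intro C
      have := ha.sum (fun E => (if E = C then 1 else 0) * Φ E)
      simp only [clInd_def]
      rw [this]
      refine Finset.sum_congr rfl fun h _ => ?_
      simp only [Equiv.symm_apply_eq]
    rw [← t, ← t, ← h]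
    choose r hr using fun E : ConjClasses G => ConjClasses.exists_rep (σ E)
    have := ha.sum (fun E => (classConst (σ C) (σ D) (r E) : ℂ) * Φ E)
    have e1 : ∀ g : G, classConst (σ C) (σ D) (r (ConjClasses.mk g)) = classConst C D g :=
      fun g => (ha C D g _ (hr _).symm).symm
    have e2 : ∀ h : H, classConst (σ C) (σ D) (r (σ.symm (ConjClasses.mk h))) =
        classConst (σ C) (σ D) h := by
      intro h
      obtain ⟨z, hz⟩ := ConjClasses.exists_rep (σ.symm (ConjClasses.mk h))
      have hz' : σ (ConjClasses.mk z) = ConjClasses.mk h := by rw [hz]; simp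
      rw [← hz, e1, ha C D z h hz']
    simp only [e1, e2] at this
    exact this.symm

theorem CCMatch.exists_char {G H : Type} [Group G] [Fintype G] [Group H] [Fintype H]
    {σ : ConjClasses G ≃ ConjClasses H} (ha : CCMatch σ) (χ : G → ℂ) (hχ : IsIrrChar G χ) :
    ∃ ψ : H → ℂ, IsIrrChar H ψ ∧
      ∀ z w, σ (ConjClasses.mk z) = ConjClasses.mk w → χ z = ψ w := by
  obtain ⟨V, hV, rfl⟩ := hχ
  have hs := sph_of_simple V
  have hd := deg_ne_zero V
  choose r hr using fun E : ConjClasses G => ConjClasses.exists_rep E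
  have hcl : ∀ a b : G, ConjClasses.mk a = ConjClasses.mk b → V.character a = V.character b := by
    intro a b hab
    obtain ⟨y, rfl⟩ := isConj_iff.1 (ConjClasses.mk_eq_mk_iff_isConj.1 hab)
    exact (V.char_conj a y).symm
  let Φ : ConjClasses G → ℂ := fun E => V.character (r E) / V.character 1
  have hΦ : ∀ g, Φ (ConjClasses.mk g) = V.character g / V.character 1 := fun g => by
    simp only [Φ]
    rw [hcl _ _ (hr (ConjClasses.mk g))]
  simp only [← hΦ] at hs
  obtain ⟨W, hW, hWc⟩ := exists_of_sph _ (ha.sph Φ hs)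
  refine ⟨W.character, ⟨W, hW, rfl⟩, ?_⟩
  have nV := (FDRep.simple_iff_char_is_norm_one V).1 hV
  have nW := (FDRep.simple_iff_char_is_norm_one W).1 hW
  have hVc : ∀ g, V.character g = V.character 1 * Φ (ConjClasses.mk g) := fun g => by
    rw [hΦ]; field_simp
  have hcard : (Nat.card G : ℂ) = Nat.card H := by
    have := ha.sum (fun _ => 1)
    simpa using this
  have e : ∑ g : G, Φ (ConjClasses.mk g) * Φ (ConjClasses.mk g⁻¹) =
      ∑ h : H, Φ (σ.symm (ConjClasses.mk h)) * Φ (σ.symm (ConjClasses.mk h⁻¹)) := by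
    have := ha.sum (fun E => Φ E * Φ (ConjClasses.mk (r E)⁻¹))
    simp only [mk_inv (hr (ConjClasses.mk _))] at this
    rw [this]
    refine Finset.sum_congr rfl fun h _ => ?_
    congr 2
    rw [Equiv.eq_symm_apply]
    exact ha.inv _ _ (by rw [hr]; simp)
  have nV' : V.character 1 ^ 2 * ∑ g : G, Φ (ConjClasses.mk g) * Φ (ConjClasses.mk g⁻¹) =
      Nat.card G := by
    rw [← nV, Finset.mul_sum]
    refine Finset.sum_congr rfl fun g _ => ?_
    rw [hVc g, hVc g⁻¹]; ring
  have nW' : W.character 1 ^ 2 *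
      ∑ h : H, Φ (σ.symm (ConjClasses.mk h)) * Φ (σ.symm (ConjClasses.mk h⁻¹)) =
      Nat.card H := by
    rw [← nW, Finset.mul_sum]
    refine Finset.sum_congr rfl fun g _ => ?_
    rw [hWc g, hWc g⁻¹]; ring
  have hne : (Nat.card H : ℂ) ≠ 0 := Nat.cast_ne_zero.2 (Nat.card_pos (α := H)).ne'
  rw [e, hcard, ← nW'] at nV'
  have hsum : ∑ h : H, Φ (σ.symm (ConjClasses.mk h)) * Φ (σ.symm (ConjClasses.mk h⁻¹)) ≠ 0 := by
    intro h0
    rw [h0, mul_zero] at nW'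
    exact hne nW'.symm
  have hsq := mul_right_cancel₀ hsum nV'
  have hdeg : V.character 1 = W.character 1 := by
    rw [FDRep.char_one, FDRep.char_one] at hsq ⊢
    have : (Module.finrank ℂ V) ^ 2 = (Module.finrank ℂ W) ^ 2 := by exact_mod_cast hsq
    rw [Nat.pow_left_injective (n := 2) (by norm_num) this]
  intro z w h
  rw [hVc z, hWc w, hdeg, ← h]
  simp

/-- The character table of a finite group is determined (up to labeling of rows and
columns) by the structure constants of the class sums `Kᵢ⁺Kⱼ⁺ = Σₖ a_{ijk}Kₖ⁺`: if
two groups have matching structure constants under a bijection of conjugacy classes,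
then there are bijections of irreducible characters and of conjugacy classes under
which the character tables agree. -/
theorem character_table_from_class_constants (G H : Type)
    [Group G] [Fintype G] [Group H] [Fintype H]
    (σ : ConjClasses G ≃ ConjClasses H)
    (ha : ∀ (C D : ConjClasses G) (z : G) (w : H),
      σ (ConjClasses.mk z) = ConjClasses.mk w →
      classConst C D z = classConst (σ C) (σ D) w) :
    ∃ (β : IrrT G ≃ IrrT H) (τ : ConjClasses G ≃ ConjClasses H),
      ∀ (χ : IrrT G) (z : G) (w : H), τ (ConjClasses.mk z) = ConjClasses.mk w →
        χ.1 z = (β χ).1 w := by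
  have hm : CCMatch σ := ha
  choose f hf hfR using fun χ : IrrT G => hm.exists_char χ.1 χ.2
  choose f' hf' hfR' using fun ψ : IrrT H => hm.symm.exists_char ψ.1 ψ.2
  refine ⟨⟨fun χ => ⟨f χ, hf χ⟩, fun ψ => ⟨f' ψ, hf' ψ⟩, fun χ => ?_, fun ψ => ?_⟩, σ,
    fun χ z w h => hfR χ z w h⟩
  · apply Subtype.ext
    funext z
    obtain ⟨w, hw⟩ := ConjClasses.exists_rep (σ (ConjClasses.mk z))
    change f' ⟨f χ, hf χ⟩ z = χ.1 z
    rw [hfR χ z w hw.symm]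
    exact (hfR' ⟨f χ, hf χ⟩ w z (by rw [hw]; simp)).symm
  · apply Subtype.ext
    funext w
    obtain ⟨z, hz⟩ := ConjClasses.exists_rep (σ.symm (ConjClasses.mk w))
    change f ⟨f' ψ, hf' ψ⟩ w = ψ.1 w
    rw [hfR' ψ w z hz.symm]
    exact (hfR ⟨f' ψ, hf' ψ⟩ z w (by rw [hz]; simp)).symm

end
end

section
/- Let G be a finite group with Irr(G) = {χ₁,…,χₙ} and structure constants b_{ijk} := [χᵢχⱼ, χₖ] so that χᵢχⱼ = Σₖ b_{ijk} χₖ. Then the character table of G is determined up to permutation of rows and columns by the b_{ijk}: the matrices Mᵢ = (b_{ijk})_{j,k} satisfy Mᵢ s_l = χᵢ(g_l) s_l for the columns s_l of the character table, so T⁻¹MᵢT is diagonal with entries the values of χᵢ, and the ambiguity by signs of columns is resolved by multiplication with linear characters. -/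
open scoped BigOperators
open Finset

noncomputable section

open Representation in
theorem isIrrChar_of_irreducible {G : Type} [Group G] [Fintype G] {V : Type} [AddCommGroup V]
    [Module ℂ V] [FiniteDimensional ℂ V] (ρ : Representation ℂ G V) [IsIrreducible ρ] :
    IsIrrChar G ρ.character := by
  refine ⟨FDRep.of ρ, ?_, rfl⟩
  rw [FDRep.simple_iff_char_is_norm_one]
  have := invertibleOfNonzero (NeZero.ne (Nat.card G : ℂ))
  have h := char_orthonormal ρ ρ
  rw [if_pos ⟨Representation.Equiv.refl ρ⟩, inv_mul_eq_one₀ (NeZero.ne (Nat.card G : ℂ))] at h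
  exact h.symm

theorem irr_class {G : Type} [Group G] [Fintype G] (χ : IrrT G) (g h : G) :
    χ.1 (h * g * h⁻¹) = χ.1 g := by
  obtain ⟨χ, V, hV, rfl⟩ := χ
  exact V.char_conj g h

open Classical in
theorem irr_orth_s16 {G : Type} [Group G] [Fintype G] (χ ψ : IrrT G) :
    innerChar G χ.1 ψ.1 = if χ = ψ then 1 else 0 := by
  have := invertibleOfNonzero (NeZero.ne (Nat.card G : ℂ))
  obtain ⟨V, hV, eV⟩ := χ.2
  obtain ⟨W, hW, eW⟩ := ψ.2
  have h := FDRep.char_orthonormal V W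
  have h1 := FDRep.char_orthonormal V V
  rw [if_pos ⟨CategoryTheory.Iso.refl V⟩] at h1
  unfold innerChar
  rw [← Nat.card_eq_fintype_card]
  rw [eV, eW]
  by_cases hn : Nonempty (V ≅ W)
  · have e := FDRep.char_iso hn.some
    have e2 : χ = ψ := Subtype.ext (by rw [eV, eW, e])
    rw [if_pos e2]
    simpa [hn] using h
  · rw [if_neg]
    · simpa [hn] using h
    · intro e
      have e' : V.character = W.character := by rw [← eV, ← eW, e]
      rw [← e', h1, if_neg hn] at h
      exact one_ne_zero h

open Representation in
theorem sum_rep_zero {G : Type} [Group G] [Fintype G] (f : G → ℂ)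
    (hf : ∀ g h, f (h * g * h⁻¹) = f g)
    (h0 : ∀ χ : IrrT G, innerChar G f χ.1 = 0) {V : Type} [AddCommGroup V]
    [Module ℂ V] [FiniteDimensional ℂ V] (ρ : Representation ℂ G V) [IsIrreducible ρ] :
    ∑ g, f g • ρ g⁻¹ = 0 := by
  let T : IntertwiningMap ρ ρ := ⟨∑ g, f g • ρ g⁻¹, by
    intro x
    change (∑ g, f g • ρ g⁻¹) * ρ x = ρ x * (∑ g, f g • ρ g⁻¹)
    rw [Finset.sum_mul, Finset.mul_sum]
    refine Fintype.sum_equiv (MulAut.conj x⁻¹).toEquiv _ _ fun g => ?_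
    simp only [MulEquiv.toEquiv_eq_coe, EquivLike.coe_coe, MulAut.conj_apply, hf,
      smul_mul_assoc, mul_smul_comm, ← map_mul]
    congr 2
    group⟩
  obtain ⟨c, hc⟩ := (IsIrreducible.algebraMap_intertwiningMap_bijective_of_isAlgClosed
    (ρ := ρ) (k := ℂ)).2 T
  have hc' : ∑ g, f g • ρ g⁻¹ = c • (1 : Module.End ℂ V) := by
    have := congrArg IntertwiningMap.toLinearMap hc
    exact this.symm
  have ht := congrArg (LinearMap.trace ℂ V) hc'
  have h1 := h0 ⟨_, isIrrChar_of_irreducible ρ⟩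
  have h2 : ∑ g, f g * ρ.character g⁻¹ = 0 := by
    unfold innerChar at h1
    simpa using h1
  have : Nontrivial V := IsSimpleModule.nontrivial (MonoidAlgebra ℂ G) ρ.asModule
  have hpos : (Module.finrank ℂ V : ℂ) ≠ 0 := by
    exact_mod_cast Module.finrank_pos.ne'
  have hcz : c = 0 := by
    simp only [map_sum, map_smul, smul_eq_mul, LinearMap.trace_one] at ht
    change ∑ g, f g * ρ.character g⁻¹ = _ at ht
    rw [h2] at ht
    simpa [hpos] using ht.symm
  rw [hc', hcz, zero_smul]

open Representation in
theorem simple_smul_zero {G : Type} [Group G] [Fintype G] (f : G → ℂ)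
    (hf : ∀ g h, f (h * g * h⁻¹) = f g)
    (h0 : ∀ χ : IrrT G, innerChar G f χ.1 = 0)
    (M : Type) [AddCommGroup M] [Module ℂ M] [Module (MonoidAlgebra ℂ G) M]
    [IsScalarTower ℂ (MonoidAlgebra ℂ G) M]
    [hs : IsSimpleModule (MonoidAlgebra ℂ G) M] (x : M) :
    (∑ g, MonoidAlgebra.single g⁻¹ (f g) : MonoidAlgebra ℂ G) • x = 0 := by
  let ρ : Representation ℂ G M := ofModule' M
  have hρ : ∀ (r : MonoidAlgebra ℂ G) (x : M), ρ.asAlgebraHom r x = r • x := by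
    intro r x
    have : ρ.asAlgebraHom = Algebra.lsmul ℂ ℂ M :=
      (MonoidAlgebra.lift ℂ (M →ₗ[ℂ] M) G).apply_symm_apply _
    rw [this]
    rfl
  let e : ρ.asModule ≃ₗ[MonoidAlgebra ℂ G] M :=
    { ρ.asModuleEquiv.toAddEquiv with
      map_smul' := fun r x => (ρ.asModuleEquiv_map_smul r x).trans (hρ r _) }
  have hi : IsIrreducible ρ :=
    (irreducible_iff_isSimpleModule_asModule ρ).2 (IsSimpleModule.congr e)
  have hfin : FiniteDimensional ℂ M := Module.Finite.trans (MonoidAlgebra ℂ G) _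
  have h := sum_rep_zero f hf h0 ρ
  rw [← hρ]
  simp only [map_sum, asAlgebraHom_single]
  rw [h]
  rfl

theorem class_zero {G : Type} [Group G] [Fintype G] (f : G → ℂ)
    (hf : ∀ g h, f (h * g * h⁻¹) = f g)
    (h0 : ∀ χ : IrrT G, innerChar G f χ.1 = 0) : f = 0 := by
  classical
  let a : MonoidAlgebra ℂ G := ∑ g, MonoidAlgebra.single g⁻¹ (f g)
  have ha : a ∈ Ring.jacobson (MonoidAlgebra ℂ G) := by
    simp only [Ring.jacobson, Module.jacobson, Submodule.mem_sInf]
    intro m hm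
    have hs : IsSimpleModule (MonoidAlgebra ℂ G) (MonoidAlgebra ℂ G ⧸ m) :=
      isSimpleModule_iff_isCoatom.2 hm
    have h4 := simple_smul_zero f hf h0 (MonoidAlgebra ℂ G ⧸ m) (Submodule.Quotient.mk 1)
    rw [← Submodule.Quotient.mk_smul, Submodule.Quotient.mk_eq_zero] at h4
    simpa using h4
  rw [IsSemisimpleRing.jacobson_eq_bot] at ha
  have ha0 : a = 0 := by simpa using ha
  funext g
  have := congrArg (fun x : MonoidAlgebra ℂ G => x.coeff g⁻¹) ha0
  simpa [a, Finsupp.finsetSum_apply, Finsupp.single_apply] using this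

/-- irreducible characters as functions on classes -/
def irrC {G : Type} [Group G] [Fintype G] (χ : IrrT G) : ConjClasses G → ℂ :=
  Quotient.lift χ.1 (by
    intro a b hab
    obtain ⟨c, hc⟩ := isConj_iff.1 hab
    rw [← hc, irr_class])

theorem irrC_mk {G : Type} [Group G] [Fintype G] (χ : IrrT G) (g : G) :
    irrC χ (ConjClasses.mk g) = χ.1 g := rfl

/-- pairing with an irreducible character -/
def pairC {G : Type} [Group G] [Fintype G] (χ : IrrT G) : (ConjClasses G → ℂ) →ₗ[ℂ] ℂ where
  toFun f := innerChar G (fun g => f (ConjClasses.mk g)) χ.1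
  map_add' f f' := by
    simp [innerChar, add_mul, Finset.sum_add_distrib, mul_add]
  map_smul' c f := by
    simp only [innerChar, Pi.smul_apply, smul_eq_mul, RingHom.id_apply, mul_assoc,
      ← Finset.mul_sum]
    ring

open Classical in
theorem pairC_irrC {G : Type} [Group G] [Fintype G] (χ ψ : IrrT G) :
    pairC χ (irrC ψ) = if ψ = χ then 1 else 0 := irr_orth_s16 ψ χ

theorem pairC_ext {G : Type} [Group G] [Fintype G] (f f' : ConjClasses G → ℂ)
    (h : ∀ χ, pairC χ f = pairC χ f') : f = f' := by
  rw [← sub_eq_zero]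
  have := class_zero (fun g => (f - f') (ConjClasses.mk g)) (fun g h => by
    have : ConjClasses.mk (h * g * h⁻¹) = ConjClasses.mk g :=
      ConjClasses.mk_eq_mk_iff_isConj.2 (isConj_iff.2 ⟨h, rfl⟩).symm
    simp only [this]) (fun χ => by
      have : pairC χ (f - f') = 0 := by rw [map_sub, h, sub_self]
      exact this)
  funext c
  induction c using Quotient.inductionOn with
  | h g => exact congrFun this g

theorem irrC_li {G : Type} [Group G] [Fintype G] :
    LinearIndependent ℂ (irrC : IrrT G → _) := by
  classical
  rw [linearIndependent_iff]
  intro l hl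
  ext χ
  have := congrArg (pairC χ) hl
  simpa [Finsupp.linearCombination_apply, Finsupp.sum, pairC_irrC] using this

instance irr_finite {G : Type} [Group G] [Fintype G] : Finite (IrrT G) :=
  irrC_li.finite

theorem irrC_expand {G : Type} [Group G] [Fintype G] [Fintype (IrrT G)] (f : ConjClasses G → ℂ) :
    f = ∑ χ : IrrT G, pairC χ f • irrC χ := by
  classical
  apply pairC_ext
  intro χ
  simp [pairC_irrC]

/-- the basis of irreducible characters -/
def irrB (G : Type) [Group G] [Fintype G] : Module.Basis (IrrT G) ℂ (ConjClasses G → ℂ) :=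
  Module.Basis.mk irrC_li (by
    have := Fintype.ofFinite (IrrT G)
    intro f _
    rw [irrC_expand f]
    exact Submodule.sum_mem _ fun χ _ => Submodule.smul_mem _ _ (Submodule.subset_span ⟨χ, rfl⟩))

theorem irrB_apply {G : Type} [Group G] [Fintype G] (χ : IrrT G) : irrB G χ = irrC χ := by
  simp [irrB]


/-- The character table of a finite group is determined (up to labeling of rows and
columns) by the structure constants `b_{ijk} = [χᵢχⱼ, χₖ]` of the character ring: if
two groups have matching structure constants under a bijection of irreducible
characters, then there are bijections of irreducible characters and of conjugacy
classes under which the character tables agree. -/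
theorem character_table_from_tensor_constants (G H : Type)
    [Group G] [Fintype G] [Group H] [Fintype H]
    (β₀ : IrrT G ≃ IrrT H)
    (hb : ∀ χ ψ ξ : IrrT G,
      innerChar G (fun g => χ.1 g * ψ.1 g) ξ.1 =
        innerChar H (fun h => (β₀ χ).1 h * (β₀ ψ).1 h) (β₀ ξ).1) :
    ∃ (β : IrrT G ≃ IrrT H) (τ : ConjClasses G ≃ ConjClasses H),
      ∀ (χ : IrrT G) (z : G) (w : H), τ (ConjClasses.mk z) = ConjClasses.mk w →
        χ.1 z = (β χ).1 w := by
  have := Fintype.ofFinite (IrrT G)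
  have := Fintype.ofFinite (IrrT H)
  let Φ : (ConjClasses G → ℂ) ≃ₗ[ℂ] (ConjClasses H → ℂ) := (irrB G).equiv (irrB H) β₀
  have hΦ : ∀ χ, Φ (irrC χ) = irrC (β₀ χ) := by
    intro χ
    rw [← irrB_apply, ← irrB_apply]
    simp [Φ]
  have hmulB : ∀ χ ψ, Φ (irrC χ * irrC ψ) = irrC (β₀ χ) * irrC (β₀ ψ) := by
    intro χ ψ
    rw [irrC_expand (irrC χ * irrC ψ), irrC_expand (irrC (β₀ χ) * irrC (β₀ ψ)), map_sum]
    refine Fintype.sum_equiv β₀ _ _ fun ξ => ?_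
    rw [map_smul, hΦ]
    congr 1
    exact hb χ ψ ξ
  have hmul : ∀ a b, Φ (a * b) = Φ a * Φ b := by
    intro a b
    rw [irrC_expand a, irrC_expand b]
    simp only [Finset.sum_mul_sum, map_sum, smul_mul_smul_comm, map_smul, hmulB, hΦ]
  have hone : Φ 1 = 1 := by
    obtain ⟨u, hu⟩ := Φ.surjective 1
    have := hmul u 1
    rw [mul_one, hu, one_mul] at this
    exact this.symm
  let Ψ : (ConjClasses G → ℂ) ≃ₐ[ℂ] (ConjClasses H → ℂ) := AlgEquiv.ofLinearEquiv Φ hone hmul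
  have hex : ∀ w : ConjClasses H, ∃ z : ConjClasses G, ∀ a, Φ a w = a z := by
    intro w
    obtain ⟨z, hz⟩ := AlgHom.eq_piEvalAlgHom ((Pi.evalAlgHom ℂ (fun _ => ℂ) w).comp Ψ.toAlgHom)
    exact ⟨z, fun a => DFunLike.congr_fun hz a⟩
  have hex' : ∀ z : ConjClasses G, ∃ w : ConjClasses H, ∀ a, Φ.symm a z = a w := by
    intro z
    obtain ⟨w, hw⟩ :=
      AlgHom.eq_piEvalAlgHom ((Pi.evalAlgHom ℂ (fun _ => ℂ) z).comp Ψ.symm.toAlgHom)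
    exact ⟨w, fun a => DFunLike.congr_fun hw a⟩
  choose s hs using hex
  choose t ht using hex'
  have sep : ∀ {X : Type} (x y : X), (∀ a : X → ℂ, a x = a y) → x = y := by
    classical
    intro X x y h
    by_contra hne
    have := h (Pi.single x 1)
    simp [Ne.symm hne] at this
  refine ⟨β₀, ⟨t, s, fun z => sep _ _ fun a => ?_, fun w => sep _ _ fun a => ?_⟩, ?_⟩
  · rw [← hs _ a, ← ht _ (Φ a), Φ.symm_apply_apply]
  · rw [← ht _ a, ← hs _ (Φ.symm a), Φ.apply_symm_apply]
  · intro χ z w h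
    change t (ConjClasses.mk z) = _ at h
    rw [← irrC_mk, ← irrC_mk, ← hΦ, ← h, ← ht _ (Φ _), Φ.symm_apply_apply]

end
end

section
/- Let B be a nilpotent p-block with abelian defect group P (reduced to G = P, the principal block of the abelian p-group P). Then every normalized perfect self-isometry I ∈ PI(B) with I(1_P) = 1_P and positive signs is multiplicative on irreducible characters—I(λμ) = I(λ)I(μ) for λ,μ ∈ Irr(P)—and hence is induced by an automorphism of P. Consequently PI(B) ≅ C₂ × (P ⋊ Aut(P)), where C₂ = ⟨−id⟩, the copy of P ≅ Irr(P) acts by multiplication with linear characters, and Aut(P) acts naturally on Irr(P). -/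
open scoped BigOperators
open Finset

noncomputable section

section Aux
open CategoryTheory

lemma PIaux_irr_of_hom {P : Type} [CommGroup P] [Fintype P] (χ : P →* ℂˣ) :
    IsIrrChar P (fun g => (χ g : ℂ)) := by
  let r : P →* (ℂ →ₗ[ℂ] ℂ) :=
    { toFun := fun g => (χ g : ℂ) • LinearMap.id
      map_one' := by ext; simp
      map_mul' := by intro a b; ext; simp [mul_comm] }
  have hc : (FDRep.of r).character = fun g => (χ g : ℂ) := by
    funext g
    show LinearMap.trace ℂ ℂ ((χ g : ℂ) • LinearMap.id) = _
    simp
  refine ⟨FDRep.of r, ?_, hc.symm⟩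
  rw [FDRep.simple_iff_char_is_norm_one, hc]
  simp [← Nat.card_eq_fintype_card]

lemma PIaux_hom_of_irr {P : Type} [CommGroup P] [Fintype P] (f : P → ℂ) (hf : IsIrrChar P f) :
    ∃ χ : P →* ℂˣ, f = fun g => (χ g : ℂ) := by
  obtain ⟨V, hV, rfl⟩ := hf
  have h1 := (FDRep.simple_iff_end_is_rank_one V).1 hV
  have hid : (𝟙 V) ≠ 0 := id_nonzero V
  have hs : ∀ g, ∃ c : ℂ, V.ρ g = c • LinearMap.id := by
    intro g
    let φ : V ⟶ V := (FDRep.forget₂HomLinearEquiv V V) (Rep.ofHom ⟨V.ρ g, by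
      intro h
      change V.ρ g ∘ₗ V.ρ h = V.ρ h ∘ₗ V.ρ g
      rw [← Module.End.mul_eq_comp, ← Module.End.mul_eq_comp, ← map_mul, ← map_mul, mul_comm]⟩)
    obtain ⟨c, hc⟩ := (finrank_eq_one_iff_of_nonzero' _ hid).mp h1 φ
    refine ⟨c, ?_⟩
    ext v
    have := congrArg (fun q : V ⟶ V => q.hom.hom v) hc
    exact this.symm
  choose c hc using hs
  have hch : ∀ g, V.character g = c g * Module.finrank ℂ V := by
    intro g
    show LinearMap.trace ℂ V (V.ρ g) = _
    rw [hc]; simp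
  have hcm : ∀ g h, V.character (g * h) = c g * V.character h := by
    intro g h
    show LinearMap.trace ℂ V (V.ρ (g * h)) = c g * LinearMap.trace ℂ V (V.ρ h)
    rw [map_mul, hc g]; simp [Module.End.mul_eq_comp]
  have hn := (FDRep.simple_iff_char_is_norm_one V).1 hV
  have hd : Module.finrank ℂ V = 1 := by
    have hP : (Nat.card P : ℂ) ≠ 0 := by simp
    have h0 : ∀ g, V.character g * V.character g⁻¹ = (Module.finrank ℂ V : ℂ) * Module.finrank ℂ V := by
      intro g
      rw [hch g, mul_right_comm, ← hcm, mul_inv_cancel, FDRep.char_one]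
    simp only [h0, Finset.sum_const, Finset.card_univ, ← Nat.card_eq_fintype_card, nsmul_eq_mul] at hn
    have h2 : (Module.finrank ℂ V : ℂ) * Module.finrank ℂ V = 1 := by
      apply mul_left_cancel₀ hP; rw [hn, mul_one]
    have h3 : Module.finrank ℂ V * Module.finrank ℂ V = 1 := by exact_mod_cast h2
    exact Nat.eq_one_of_mul_eq_one_left h3
  have hch' : ∀ g, V.character g = c g := by intro g; rw [hch, hd]; simp
  let m : P →* ℂ :=
    { toFun := V.character
      map_one' := by rw [FDRep.char_one, hd]; simp
      map_mul' := by intro g h; rw [hcm, hch' g] }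
  refine ⟨m.toHomUnits, ?_⟩
  funext g
  rfl

end Aux

/-- Average of roots of unity being an algebraic integer. -/
lemma PIaux_kron {ι : Type} [Fintype ι] [Nonempty ι] (z : ι → ℂ) (n : ℕ) (hn : 0 < n)
    (hz : ∀ i, z i ^ n = 1) (hi : IsIntegral ℤ ((∑ i, z i) / (Fintype.card ι : ℂ)))
    (h0 : ∑ i, z i ≠ 0) : ∀ i j, z i = z j := by
  classical
  have hN : (Fintype.card ι : ℂ) ≠ 0 := by simp
  have hNr : (0 : ℝ) < (Fintype.card ι : ℝ) := by exact_mod_cast Fintype.card_pos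
  let K := IntermediateField.adjoin ℚ (Set.range z)
  have hzi : ∀ i, IsIntegral ℚ (z i) := fun i =>
    IsIntegral.of_pow hn (by rw [hz]; exact isIntegral_one)
  have : FiniteDimensional ℚ K := IntermediateField.finiteDimensional_adjoin (by
      rintro _ ⟨i, rfl⟩; exact hzi i)
  have : NumberField K := { }
  let y : ι → K := fun i => ⟨z i, IntermediateField.subset_adjoin _ _ ⟨i, rfl⟩⟩
  have hy : ∀ i, y i ^ n = 1 := fun i => Subtype.ext (hz i)
  let a : K := (∑ i, y i) / (Fintype.card ι : K)
  have ha : (a : ℂ) = (∑ i, z i) / (Fintype.card ι : ℂ) := by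
    have : algebraMap K ℂ a = (∑ i, z i) / (Fintype.card ι : ℂ) := by
      simp only [a, map_div₀, map_sum, map_natCast]; rfl
    exact this
  have hai : IsIntegral ℤ a := by
    rw [← ha] at hi
    exact (isIntegral_algebraMap_iff (B := ℂ) (A := K) (algebraMap K ℂ).injective).1 hi
  have ha0 : a ≠ 0 := by
    intro h
    have : (a : ℂ) = 0 := by rw [h]; rfl
    rw [ha] at this
    exact h0 ((div_eq_zero_iff.1 this).resolve_right hN)
  obtain ⟨m, hm, hpow⟩ := NumberField.Embeddings.pow_eq_one_of_norm_le_one K ℂ ha0 hai (by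
    intro φ
    simp only [a, map_div₀, map_sum, map_natCast, norm_div, Complex.norm_natCast]
    rw [div_le_one hNr]
    refine (norm_sum_le _ _).trans ?_
    have : ∀ i, ‖φ (y i)‖ = 1 := fun i =>
      Complex.norm_eq_one_of_pow_eq_one (n := n) (by rw [← map_pow, hy, map_one]) hn.ne'
    simp [this])
  have hna : ‖(a : ℂ)‖ = 1 :=
    Complex.norm_eq_one_of_pow_eq_one (n := m) (by
      have := congrArg (fun t : K => (t : ℂ)) hpow
      simpa using this) hm.ne'
  set w : ℂ := (a : ℂ) with hw
  have hzn : ∀ i, ‖z i‖ = 1 := fun i => Complex.norm_eq_one_of_pow_eq_one (hz i) hn.ne'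
  have hww : w * star w = 1 := by
    have := Complex.mul_conj w
    rw [Complex.normSq_eq_norm_sq, hna] at this
    simpa using this
  have hle : ∀ i, (z i * star w).re ≤ 1 := fun i => by
    refine (Complex.re_le_norm _).trans ?_
    rw [norm_mul, norm_star, hzn, hna]; simp
  have hsum : ∑ i, z i = (Fintype.card ι : ℂ) * w := by
    rw [ha]; field_simp
  have hsum2 : ∑ i, (z i * star w).re = ∑ i : ι, (1 : ℝ) := by
    rw [← Complex.re_sum, ← Finset.sum_mul, hsum, mul_assoc, hww]; simp
  have hall := (Finset.sum_eq_sum_iff_of_le (fun i _ => hle i)).1 hsum2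
  have hz1 : ∀ i, z i = w := by
    intro i
    have hr : (z i * star w).re = 1 := hall i (Finset.mem_univ _)
    have hnn : ‖z i * star w‖ = 1 := by rw [norm_mul, norm_star, hzn, hna]; simp
    have him : (z i * star w).im = 0 := by
      have h2 := Complex.sq_norm (z i * star w)
      rw [hnn, Complex.normSq_apply, hr] at h2
      nlinarith
    have h1 : z i * star w = 1 := Complex.ext (by simpa using hr) (by simpa using him)
    calc z i = z i * (w * star w) := by rw [hww, mul_one]
      _ = w * (z i * star w) := by ring
      _ = w := by rw [h1, mul_one]
  intro i j; rw [hz1 i, hz1 j]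

/-- Sum of the values of a linear character. -/
lemma PIaux_sum {G : Type} [Group G] [Fintype G] (f : G →* ℂˣ) (h : f ≠ 1) :
    ∑ g, (f g : ℂ) = 0 := by
  obtain ⟨a, ha⟩ : ∃ a, f a ≠ 1 := by
    by_contra hc; push Not at hc; exact h (MonoidHom.ext hc)
  have h1 : (f a : ℂ) * ∑ g, (f g : ℂ) = ∑ g, (f g : ℂ) := by
    rw [Finset.mul_sum]
    refine Fintype.sum_equiv (Equiv.mulLeft a) _ _ (fun x => by simp)
  have h2 : ((f a : ℂ) - 1) * ∑ g, (f g : ℂ) = 0 := by rw [sub_mul, h1]; ring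
  rcases mul_eq_zero.1 h2 with h3 | h3
  · exact absurd (Units.ext (by simpa using sub_eq_zero.1 h3)) ha
  · exact h3

/-- The dual group. -/
abbrev PIauxD (P : Type) [CommGroup P] : Type := P →* ℂˣ

set_option linter.unusedSectionVars false

section Aux2
variable {P : Type} [CommGroup P] [Fintype P] [Fintype (PIauxD P)] {B : Finset (P → ℂ)}

lemma PIaux_mem (hB : ∀ χ, χ ∈ B ↔ IsIrrChar P χ) (f : P → ℂ) :
    f ∈ B ↔ ∃ χ : PIauxD P, (fun g => (χ g : ℂ)) = f := by
  rw [hB]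
  constructor
  · intro h
    obtain ⟨χ, h⟩ := PIaux_hom_of_irr f h
    exact ⟨χ, h.symm⟩
  · rintro ⟨χ, rfl⟩
    exact PIaux_irr_of_hom χ

lemma PIaux_coe_inj {χ ψ : PIauxD P} (h : (fun g => (χ g : ℂ)) = fun g => (ψ g : ℂ)) : χ = ψ :=
  MonoidHom.ext fun g => Units.ext (congrFun h g)

lemma PIaux_basis (hB : ∀ χ, χ ∈ B ↔ IsIrrChar P χ) :
    ∃ b : Module.Basis (PIauxD P) ℤ (ZIrr B), ∀ χ g, (b χ : P → ℂ) g = (χ g : ℂ) := by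
  have h0 := linearIndependent_monoidHom P ℂ
  let e : PIauxD P → (P → ℂ) := fun χ g => (χ g : ℂ)
  have h1 : LinearIndependent ℂ e := by
    have := h0.comp (fun χ : PIauxD P => (Units.coeHom ℂ).comp χ) (by
      intro χ ψ h
      apply PIaux_coe_inj
      funext g
      exact DFunLike.congr_fun h g)
    exact this
  have h2 : LinearIndependent ℤ e := h1.restrict_scalars (by
    intro a b hab; simpa using hab)
  have hr : Set.range e = (B : Set (P → ℂ)) := by
    ext f
    rw [Finset.mem_coe, PIaux_mem hB]; rfl
  refine ⟨(Module.Basis.span h2).map (LinearEquiv.ofEq _ _ (by rw [hr]; rfl)), fun χ g => ?_⟩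
  simp only [Module.Basis.map_apply, LinearEquiv.coe_ofEq_apply]
  rw [Module.Basis.span_apply]

lemma PIaux_card : (Fintype.card (PIauxD P)) = Fintype.card P := by
  rw [← Nat.card_eq_fintype_card, ← Nat.card_eq_fintype_card]
  exact CommGroup.card_monoidHom_of_hasEnoughRootsOfUnity P ℂ

lemma PIaux_orth [DecidableEq (PIauxD P)] (χ ψ : PIauxD P) :
    ∑ g, (χ g : ℂ) * (ψ g⁻¹ : ℂ) = if χ = ψ then (Fintype.card P : ℂ) else 0 := by
  have h : ∀ g, (χ g : ℂ) * (ψ g⁻¹ : ℂ) = ((χ / ψ) g : ℂ) := by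
    intro g
    simp [div_eq_mul_inv]
  simp only [h]
  split_ifs with hc
  · subst hc; simp
  · exact PIaux_sum _ (fun h => hc (div_eq_one.1 h))

/-- Fourier inversion. -/
lemma PIaux_fourier (F : PIauxD P → ℂ) (ψ : PIauxD P) :
    ∑ g, (∑ χ : PIauxD P, F χ * (χ g : ℂ)) * (ψ g⁻¹ : ℂ) = Fintype.card P * F ψ := by
  classical
  simp only [Finset.sum_mul, mul_assoc]
  rw [Finset.sum_comm]
  simp only [← Finset.mul_sum, PIaux_orth]
  simp [mul_comm]

lemma PIaux_inner (b : Module.Basis (PIauxD P) ℤ (ZIrr B))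
    (hb : ∀ χ g, (b χ : P → ℂ) g = (χ g : ℂ)) (x y : ZIrr B) :
    innerChar P (x : P → ℂ) (y : P → ℂ) = ((∑ χ, b.repr x χ * b.repr y χ : ℤ) : ℂ) := by
  classical
  have hx : ∀ (x : ZIrr B) (g : P), (x : P → ℂ) g = ∑ χ, (b.repr x χ : ℂ) * (χ g : ℂ) := by
    intro x g
    conv_lhs => rw [← b.sum_repr x]
    simp [-Module.Basis.sum_repr, Submodule.coe_sum, Finset.sum_apply, hb]
  unfold innerChar
  have hP : (Fintype.card P : ℂ) ≠ 0 := by simp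
  have h1 : ∑ g, (x : P → ℂ) g * (y : P → ℂ) g⁻¹
      = ∑ ψ, (∑ g, (∑ χ : PIauxD P, (b.repr x χ : ℂ) * (χ g : ℂ)) * (ψ g⁻¹ : ℂ)) * (b.repr y ψ : ℂ) := by
    simp only [Finset.sum_mul (s := (Finset.univ : Finset P))]
    rw [Finset.sum_comm]
    refine Finset.sum_congr rfl fun g _ => ?_
    rw [hx x, hx y, Finset.mul_sum]
    refine Finset.sum_congr rfl fun χ _ => ?_
    ring
  rw [h1]
  simp only [PIaux_fourier]
  simp only [mul_assoc]
  rw [← Finset.mul_sum, inv_mul_cancel_left₀ hP]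
  push_cast
  rfl

lemma PIaux_mu (hB : ∀ χ, χ ∈ B ↔ IsIrrChar P χ) (b : Module.Basis (PIauxD P) ℤ (ZIrr B))
    (hb : ∀ χ g, (b χ : P → ℂ) g = (χ g : ℂ)) (I : ZIrr B →ₗ[ℤ] ZIrr B) (g h : P) :
    muI I g h = ∑ χ : PIauxD P, (χ g : ℂ) * ((I (b χ) : ZIrr B) : P → ℂ) h := by
  unfold muI
  symm
  refine Finset.sum_bij (fun χ _ => ⟨fun g => (χ g : ℂ), (PIaux_mem hB _).2 ⟨χ, rfl⟩⟩)
    ?_ ?_ ?_ ?_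
  · intro χ _; exact Finset.mem_attach _ _
  · intro χ _ ψ _ h
    exact PIaux_coe_inj (Subtype.ext_iff.1 h)
  · rintro ⟨f, hf⟩ _
    obtain ⟨χ, rfl⟩ := (PIaux_mem hB f).1 hf
    exact ⟨χ, Finset.mem_univ _, rfl⟩
  · intro χ _
    have : b χ = elt (fun g => (χ g : ℂ)) ((PIaux_mem hB _).2 ⟨χ, rfl⟩) :=
      Subtype.ext (funext fun g => hb χ g)
    rw [this]

end Aux2

lemma PIaux_int {ι : Type} [Fintype ι] (m : ι → ℤ) (h : ∑ i, m i * m i = 1) :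
    ∃ (i : ι) (e : ℤˣ), m i = e ∧ ∀ j, j ≠ i → m j = 0 := by
  classical
  obtain ⟨i, hi⟩ : ∃ i, m i ≠ 0 := by
    by_contra hc; push Not at hc; simp [hc] at h
  have hs := Finset.add_sum_erase Finset.univ (fun i => m i * m i) (Finset.mem_univ i)
  have hnn : ∀ j ∈ Finset.univ.erase i, 0 ≤ m j * m j := fun j _ => mul_self_nonneg _
  have h1 : 1 ≤ m i * m i := by
    have : 0 < m i * m i := mul_self_pos.2 hi
    omega
  have h2 := Finset.sum_nonneg hnn
  simp only [h] at hs
  have h3 : m i * m i = 1 := by omega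
  have h4 : ∑ j ∈ Finset.univ.erase i, m j * m j = 0 := by omega
  refine ⟨i, Units.mkOfMulEqOne _ _ h3, rfl, fun j hj => ?_⟩
  have := (Finset.sum_eq_zero_iff_of_nonneg hnn).1 h4 j (by simp [hj])
  exact mul_self_eq_zero.1 this

lemma PIaux_regular {p : ℕ} [Fact p.Prime] {P : Type} [CommGroup P]
    (hP : IsPGroup p P) (g : P) : pRegular p g ↔ g = 1 := by
  have hp : p.Prime := Fact.out
  unfold pRegular
  obtain ⟨k, hk⟩ := IsPGroup.iff_orderOf.1 hP g
  constructor
  · intro h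
    rw [hk] at h
    have : k = 0 := by
      by_contra hc; exact h (dvd_pow_self p hc)
    rw [this, pow_zero] at hk
    exact orderOf_eq_one_iff.1 hk
  · rintro rfl
    rw [orderOf_one]
    exact hp.one_lt.ne' ∘ Nat.dvd_one.1

lemma PIaux_cent {p : ℕ} [Fact p.Prime] {P : Type} [CommGroup P] [Fintype P]
    (hP : IsPGroup p P) (g : P) : centOrderP p g = Fintype.card P := by
  have hp : p.Prime := Fact.out
  unfold centOrderP pPart
  have h1 : Subgroup.centralizer ({g} : Set P) = ⊤ := by
    ext x; simp [Subgroup.mem_centralizer_iff, mul_comm]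
  rw [h1, Subgroup.card_top]
  obtain ⟨n, hn⟩ := IsPGroup.iff_card.1 hP
  rw [← Nat.card_eq_fintype_card, hn, hp.factorization_pow]; simp

section Aux3
variable {P : Type} [CommGroup P] [Fintype P] [Fintype (PIauxD P)] {B : Finset (P → ℂ)}

lemma PIaux_one_mul (χ : PIauxD P) : 1 * χ = χ := one_mul χ
lemma PIaux_mul_one (χ : PIauxD P) : χ * 1 = χ := mul_one χ
lemma PIaux_inv_mul (χ : PIauxD P) : χ⁻¹ * χ = 1 := inv_mul_cancel χ
lemma PIaux_cancel (l χ ψ : PIauxD P) : l * χ = l * ψ ↔ χ = ψ := mul_right_inj l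

/-- The holomorph acting on `ℤIrr`. -/
def PIauxL (b : Module.Basis (PIauxD P) ℤ (ZIrr B)) :
    ℤˣ × (PIauxD P ⋊[MonoidHom.id (MulAut (PIauxD P))] MulAut (PIauxD P)) →*
      Module.End ℤ (ZIrr B) where
  toFun x := b.constr ℤ (fun χ => (x.1 : ℤ) • b (x.2.left * x.2.right χ))
  map_one' := b.ext fun χ => by simp [PIaux_one_mul]
  map_mul' x y := b.ext fun χ => by
    simp only [Prod.fst_mul, Units.val_mul, Prod.snd_mul, SemidirectProduct.mul_left,
      SemidirectProduct.mul_right, MonoidHom.id_apply, MulAut.mul_apply,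
      Module.Basis.constr_basis, Module.End.mul_apply, map_smul, map_mul, smul_smul, mul_assoc]
    rw [mul_comm]

def PIauxPhi (b : Module.Basis (PIauxD P) ℤ (ZIrr B)) :
    ℤˣ × (PIauxD P ⋊[MonoidHom.id (MulAut (PIauxD P))] MulAut (PIauxD P)) →*
      ((ZIrr B) ≃ₗ[ℤ] (ZIrr B)) :=
  (LinearMap.GeneralLinearGroup.generalLinearEquiv ℤ (ZIrr B)).toMonoidHom.comp
    (PIauxL b).toHomUnits

lemma PIauxPhi_apply (b : Module.Basis (PIauxD P) ℤ (ZIrr B)) (x) (χ : PIauxD P) :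
    PIauxPhi b x (b χ) = (x.1 : ℤ) • b (x.2.left * x.2.right χ) := by
  show PIauxL b x (b χ) = _
  exact b.constr_basis ℤ _ χ

lemma PIaux_smul_inj (b : Module.Basis (PIauxD P) ℤ (ZIrr B)) (e f : ℤˣ) (χ ψ : PIauxD P)
    (hb : ∀ χ g, (b χ : P → ℂ) g = (χ g : ℂ))
    (h : (e : ℤ) • b χ = (f : ℤ) • b ψ) : e = f ∧ χ = ψ := by
  have h1 : ∀ g, ((e : ℤ) : ℂ) * (χ g : ℂ) = ((f : ℤ) : ℂ) * (ψ g : ℂ) := by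
    intro g
    have := congrFun (congrArg Subtype.val h) g
    simpa [hb] using this
  have h2 : e = f := by
    have := h1 1
    simp only [map_one, Units.val_one, mul_one] at this
    exact Units.ext (by exact_mod_cast this)
  refine ⟨h2, ?_⟩
  subst h2
  refine MonoidHom.ext fun g => Units.ext ?_
  refine mul_left_cancel₀ ?_ (h1 g)
  exact_mod_cast e.ne_zero

lemma PIauxPhi_inj (b : Module.Basis (PIauxD P) ℤ (ZIrr B))
    (hb : ∀ χ g, (b χ : P → ℂ) g = (χ g : ℂ)) : Function.Injective (PIauxPhi b) := by
  rintro ⟨e, l, β⟩ ⟨f, m, γ⟩ h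
  have h1 : ∀ χ, e = f ∧ l * β χ = m * γ χ := by
    intro χ
    apply PIaux_smul_inj b e f _ _ hb
    have := congrArg (fun I => I (b χ)) h
    simpa [PIauxPhi_apply, PIaux_mul_one] using this
  have he := (h1 1).1
  have hl : l = m := by simpa using (h1 1).2
  have hβ : β = γ := by
    ext1 χ
    have := (h1 χ).2
    rw [hl] at this
    exact mul_left_cancel this
  rw [he, hl, hβ]

lemma PIaux_eval_ne {g : P} (hg : g ≠ 1) : ∑ χ : PIauxD P, (χ g : ℂ) = 0 := by
  obtain ⟨φ, hφ⟩ := CommGroup.exists_apply_ne_one_of_hasEnoughRootsOfUnity P ℂ hg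
  exact PIaux_sum (MonoidHom.eval g : PIauxD P →* ℂˣ) (fun h => hφ (DFunLike.congr_fun h φ))

lemma PIauxPhi_perf {p : ℕ} [Fact p.Prime] (hP : IsPGroup p P)
    (hB : ∀ χ, χ ∈ B ↔ IsIrrChar P χ) (b : Module.Basis (PIauxD P) ℤ (ZIrr B))
    (hb : ∀ χ g, (b χ : P → ℂ) g = (χ g : ℂ)) (x) : IsPerfIso p B B (PIauxPhi b x) := by
  have hN : (Fintype.card P : ℂ) ≠ 0 := by simp
  obtain ⟨e, l, β⟩ := x
  have hmu : ∀ g h, muI (PIauxPhi b (e, ⟨l, β⟩)).toLinearMap g h =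
      ((e : ℤ) : ℂ) * (l h : ℂ) * ∑ χ : PIauxD P,
        (((MonoidHom.eval g * (MonoidHom.eval h).comp β.toMonoidHom : PIauxD P →* ℂˣ) χ : ℂˣ) : ℂ) := by
    intro g h
    rw [PIaux_mu hB b hb, Finset.mul_sum]
    refine Finset.sum_congr rfl fun χ _ => ?_
    rw [LinearEquiv.coe_coe, PIauxPhi_apply]
    simp [hb]
    ring
  have hint : ∀ g h, IsIntegral ℤ (muI (PIauxPhi b (e, ⟨l, β⟩)).toLinearMap g h /
      (Fintype.card P : ℂ)) := by
    intro g h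
    rw [hmu]
    by_cases hc : (MonoidHom.eval g * (MonoidHom.eval h).comp β.toMonoidHom : PIauxD P →* ℂˣ) = 1
    · rw [hc]
      simp only [MonoidHom.one_apply, Units.val_one, Finset.sum_const, Finset.card_univ,
        PIaux_card, nsmul_eq_mul, mul_one]
      rw [mul_div_assoc, div_self hN, mul_one]
      refine IsIntegral.mul ?_ ?_
      · exact isIntegral_algebraMap (R := ℤ) (A := ℂ) (x := (e : ℤ))
      · refine IsIntegral.of_pow (n := Fintype.card P) Fintype.card_pos ?_
        rw [← Units.val_pow_eq_pow_val, ← map_pow, pow_card_eq_one]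
        simpa using isIntegral_one
    · rw [PIaux_sum _ hc]; simpa using isIntegral_zero
  refine ⟨?_, ?_, ?_⟩
  · intro x y
    have hr : ∀ (x : ZIrr B) χ, b.repr (PIauxPhi b (e, ⟨l, β⟩) x) (l * β χ) = e * b.repr x χ := by
      classical
      intro x χ
      have : (Finsupp.lapply (l * β χ)) ∘ₗ b.repr.toLinearMap ∘ₗ
          (PIauxPhi b (e, ⟨l, β⟩)).toLinearMap = (e : ℤ) • (Finsupp.lapply χ ∘ₗ b.repr.toLinearMap) := by
        refine b.ext fun ψ => ?_
        simp [PIauxPhi_apply, Finsupp.single_apply, PIaux_mul_one, PIaux_cancel]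
      exact LinearMap.congr_fun this x
    rw [PIaux_inner b hb, PIaux_inner b hb]
    congr 1
    symm
    refine Fintype.sum_equiv (β.toEquiv.trans (Equiv.mulLeft l)) _ _ (fun χ => ?_)
    show _ = b.repr (PIauxPhi b (e, ⟨l, β⟩) x) (l * β χ) * b.repr (PIauxPhi b (e, ⟨l, β⟩) y) (l * β χ)
    rw [hr, hr]
    have he : (e : ℤ) * e = 1 := by rw [← Units.val_mul, Int.units_mul_self]; rfl
    linear_combination (-(b.repr x χ * b.repr y χ)) * he
  · intro g h hx
    simp only [PIaux_regular hP] at hx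
    rw [hmu]
    have : ∑ χ : PIauxD P,
        (((MonoidHom.eval g * (MonoidHom.eval h).comp β.toMonoidHom : PIauxD P →* ℂˣ) χ : ℂˣ) : ℂ) = 0 := by
      rcases hx with ⟨rfl, hh⟩ | ⟨rfl, hg⟩
      · rw [← PIaux_eval_ne hh]
        exact Fintype.sum_equiv β.toEquiv _ _ (fun χ => by simp)
      · rw [← PIaux_eval_ne hg]
        exact Finset.sum_congr rfl (fun χ _ => by simp)
    rw [this, mul_zero]
  · intro g h
    rw [PIaux_cent hP, PIaux_cent hP]
    exact ⟨hint g h, hint g h⟩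

lemma PIaux_surj {p : ℕ} [Fact p.Prime] (hP : IsPGroup p P)
    (hB : ∀ χ, χ ∈ B ↔ IsIrrChar P χ) (b : Module.Basis (PIauxD P) ℤ (ZIrr B))
    (hb : ∀ χ g, (b χ : P → ℂ) g = (χ g : ℂ)) (I : ZIrr B ≃ₗ[ℤ] ZIrr B)
    (hI : IsPerfIso p B B I) : ∃ x, PIauxPhi b x = I := by
  classical
  have hN : (Fintype.card P : ℂ) ≠ 0 := by simp
  obtain ⟨hiso, hsep, hint⟩ := hI
  have hex : ∀ χ : PIauxD P, ∃ (ψ : PIauxD P) (e : ℤˣ), I (b χ) = (e : ℤ) • b ψ := by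
    intro χ
    have h1 := hiso (b χ) (b χ)
    rw [PIaux_inner b hb, PIaux_inner b hb] at h1
    have h2 : ∑ ψ, b.repr (I (b χ)) ψ * b.repr (I (b χ)) ψ = 1 := by
      have h3 : ∑ ψ, b.repr (b χ) ψ * b.repr (b χ) ψ = 1 := by
        simp [Finsupp.single_apply]
      rw [h3] at h1
      exact_mod_cast h1
    obtain ⟨ψ, e, he, h0⟩ := PIaux_int _ h2
    refine ⟨ψ, e, b.repr.injective ?_⟩
    ext η
    by_cases hη : η = ψ
    · subst hη; simp [he]
    · rw [h0 η hη]; simp [Finsupp.single_apply, Ne.symm hη]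
  choose σ ε hσ using hex
  have hmu : ∀ g h, muI I.toLinearMap g h =
      ∑ χ : PIauxD P, ((ε χ : ℤ) : ℂ) * ((χ g : ℂ) * (σ χ h : ℂ)) := by
    intro g h
    rw [PIaux_mu hB b hb]
    refine Finset.sum_congr rfl fun χ _ => ?_
    rw [LinearEquiv.coe_coe, hσ]
    simp [hb]
    ring
  -- uniform sign
  have hε0 : ∀ ψ, (Fintype.card P : ℂ) * ((ε ψ : ℤ) : ℂ) = ∑ χ, ((ε χ : ℤ) : ℂ) := by
    intro ψ
    rw [← PIaux_fourier (fun χ => ((ε χ : ℤ) : ℂ)) ψ]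
    rw [Finset.sum_eq_single 1]
    · simp
    · intro g _ hg
      have := hsep g 1 (by
        rw [PIaux_regular hP, PIaux_regular hP]
        exact Or.inr ⟨rfl, hg⟩)
      rw [hmu] at this
      simp only [map_one, Units.val_one, mul_one] at this
      rw [this, zero_mul]
    · simp
  have hε : ∀ χ, ε χ = ε 1 := by
    intro χ
    have := mul_left_cancel₀ hN ((hε0 χ).trans (hε0 1).symm)
    exact Units.ext (by exact_mod_cast this)
  have hinj : Function.Injective σ := by
    intro χ ψ h
    have : I (b χ) = I (b ψ) := by rw [hσ, hσ, h, hε χ, hε ψ]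
    exact b.injective (I.injective this)
  have he0 : (((ε 1 : ℤˣ) : ℤ) : ℂ) * (((ε 1 : ℤˣ) : ℤ) : ℂ) = 1 := by
    have he : ((ε 1 : ℤˣ) : ℤ) * ((ε 1 : ℤˣ) : ℤ) = 1 := by
      rw [← Units.val_mul, Int.units_mul_self]; rfl
    exact_mod_cast he
  have key : ∀ h : P, ∃ g : P, ∀ χ : PIauxD P, (χ g : ℂ) * (σ χ h : ℂ) = (σ 1 h : ℂ) := by
    intro h
    obtain ⟨g, hg⟩ : ∃ g : P, ∑ χ : PIauxD P, (χ g : ℂ) * (σ χ h : ℂ) ≠ 0 := by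
      by_contra hc
      push Not at hc
      have := PIaux_fourier (fun χ : PIauxD P => (σ χ h : ℂ)) 1
      simp only [mul_comm (σ _ h : ℂ), hc] at this
      simp at this
    refine ⟨g, fun χ => ?_⟩
    have hi := (hint g h).1
    rw [PIaux_cent hP, hmu] at hi
    simp only [hε] at hi
    rw [← Finset.mul_sum] at hi
    have hi2 : IsIntegral ℤ ((∑ χ : PIauxD P, (χ g : ℂ) * (σ χ h : ℂ)) /
        (Fintype.card (PIauxD P) : ℂ)) := by
      have h4 : IsIntegral ℤ ((((ε 1 : ℤˣ) : ℤ)) : ℂ) :=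
        isIntegral_algebraMap (R := ℤ) (A := ℂ) (x := ((ε 1 : ℤˣ) : ℤ))
      have h3 := h4.mul hi
      rw [PIaux_card]
      rw [← mul_div_assoc, ← mul_assoc, he0, one_mul] at h3
      exact h3
    have := PIaux_kron (fun χ : PIauxD P => (χ g : ℂ) * (σ χ h : ℂ)) (Fintype.card P)
      Fintype.card_pos (by
        intro χ
        rw [← Units.val_mul, ← Units.val_pow_eq_pow_val, mul_pow, ← map_pow, ← map_pow,
          pow_card_eq_one, pow_card_eq_one]
        simp) hi2 hg χ 1
    simpa using this
  have key' : ∀ h : P, ∃ g : P, ∀ χ : PIauxD P, σ χ h = σ 1 h * (χ g)⁻¹ := by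
    intro h
    obtain ⟨g, hg⟩ := key h
    refine ⟨g, fun χ => ?_⟩
    have h1 : χ g * σ χ h = σ 1 h := Units.ext (by simpa using hg χ)
    rw [← h1]; simp [mul_comm]
  let β₀ : PIauxD P →* PIauxD P :=
    { toFun := fun χ => (σ 1)⁻¹ * σ χ
      map_one' := PIaux_inv_mul _
      map_mul' := by
        intro χ ψ
        ext1 h
        obtain ⟨g, hg⟩ := key' h
        simp only [MonoidHom.mul_apply, MonoidHom.inv_apply]
        rw [hg (χ * ψ), hg χ, hg ψ]
        simp [mul_comm] }
  have hβinj : Function.Injective β₀ := by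
    intro χ ψ h
    exact hinj (mul_left_cancel (a := (σ 1)⁻¹) h)
  let β : MulAut (PIauxD P) := MulEquiv.ofBijective β₀ (Finite.injective_iff_bijective.1 hβinj)
  refine ⟨(ε 1, ⟨σ 1, β⟩), ?_⟩
  apply LinearEquiv.toLinearMap_injective
  refine b.ext fun χ => ?_
  rw [LinearEquiv.coe_coe, LinearEquiv.coe_coe, PIauxPhi_apply, hσ, hε χ]
  have : σ 1 * β χ = σ χ := mul_inv_cancel_left (σ 1) (σ χ)
  show _ • b (σ 1 * β χ) = _
  rw [this]

lemma PIaux_dual (β : MulAut (PIauxD P)) :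
    ∃ α : P ≃* P, ∀ (χ : PIauxD P) g, β χ g = χ (α g) := by
  let e := CommGroup.monoidHomMonoidHomEquiv P ℂ
  let t : (PIauxD P →* ℂˣ) ≃* (PIauxD P →* ℂˣ) :=
    { toFun := fun η => η.comp β.toMonoidHom
      invFun := fun η => η.comp β.symm.toMonoidHom
      left_inv := fun η => by ext; simp
      right_inv := fun η => by ext; simp
      map_mul' := fun η θ => rfl }
  refine ⟨(e.symm.trans t).trans e, fun χ g => ?_⟩
  have := CommGroup.apply_monoidHomMonoidHomEquiv (G := P) ℂ χ (t (e.symm g))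
  refine Eq.trans ?_ this.symm
  show _ = (e.symm g) (β χ)
  simp [e]

end Aux3

/-- Let `P` be a finite abelian `p`-group and `B = Irr(P)` its unique block.  Every
normalized perfect self-isometry with positive signs is multiplicative on irreducible
characters and is induced by an automorphism of `P`; consequently the group `PI(B)`
of perfect self-isometries is isomorphic to `C₂ × (P ⋊ Aut(P))`. -/
theorem abelian_pgroup_PI (p : ℕ) [Fact p.Prime]
    (P : Type) [CommGroup P] [Fintype P] (hP : IsPGroup p P)
    (B : Finset (P → ℂ)) (hB : ∀ χ, χ ∈ B ↔ IsIrrChar P χ) :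
    (∀ I : ZIrr B ≃ₗ[ℤ] ZIrr B, IsPerfIso p B B I →
      -- normalized: the trivial character is sent to the trivial character
      (∀ χ (hχ : χ ∈ B), χ = (fun _ => 1) →
        ((I (elt χ hχ) : ZIrr B) : P → ℂ) = fun _ => 1) →
      -- positive signs
      (∀ χ (hχ : χ ∈ B), ∃ ψ ∈ B, ((I (elt χ hχ) : ZIrr B) : P → ℂ) = ψ) →
      -- conclusion: multiplicative, and induced by an automorphism of P
      ((∀ χ ψ ξ (hχ : χ ∈ B) (hψ : ψ ∈ B) (hξ : ξ ∈ B), (∀ g, ξ g = χ g * ψ g) →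
          ∀ x, ((I (elt ξ hξ) : ZIrr B) : P → ℂ) x =
            ((I (elt χ hχ) : ZIrr B) : P → ℂ) x * ((I (elt ψ hψ) : ZIrr B) : P → ℂ) x) ∧
        ∃ α : P ≃* P, ∀ χ (hχ : χ ∈ B) (g : P),
          ((I (elt χ hχ) : ZIrr B) : P → ℂ) g = χ (α g))) ∧
    ∃ PIB : Subgroup ((ZIrr B) ≃ₗ[ℤ] (ZIrr B)),
      (∀ I, I ∈ PIB ↔ IsPerfIso p B B I) ∧
      Nonempty (PIB ≃*
        Multiplicative (ZMod 2) × (P ⋊[MonoidHom.id (MulAut P)] MulAut P)) := by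
  classical
  have hfin : Finite (PIauxD P) := Finite.of_equiv P
    (CommGroup.monoidHom_mulEquiv_of_hasEnoughRootsOfUnity P ℂ).some.symm.toEquiv
  have hft : Fintype (PIauxD P) := Fintype.ofFinite _
  obtain ⟨b, hb⟩ := PIaux_basis hB
  have helt : ∀ (χ : PIauxD P) (h : (fun g => (χ g : ℂ)) ∈ B), elt _ h = b χ :=
    fun χ h => Subtype.ext (funext fun g => (hb χ g).symm)
  refine ⟨?_, ?_⟩
  · intro I hI hnorm _
    obtain ⟨⟨e, l, β⟩, rfl⟩ := PIaux_surj hP hB b hb I hI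
    have h1 : (fun g => ((1 : PIauxD P) g : ℂ)) ∈ B := (PIaux_mem hB _).2 ⟨1, rfl⟩
    have h2 := hnorm _ h1 (by funext g; simp)
    rw [helt, PIauxPhi_apply] at h2
    have h3 : (e : ℤ) • b l = ((1 : ℤˣ) : ℤ) • b 1 := by
      apply Subtype.ext
      simp only [map_one, PIaux_mul_one] at h2
      rw [h2]
      funext g
      simp [hb]
    obtain ⟨rfl, rfl⟩ := PIaux_smul_inj b e 1 l 1 hb h3
    have hact : ∀ (χ : PIauxD P) (h : (fun g => (χ g : ℂ)) ∈ B) (x : P),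
        ((PIauxPhi b (1, ⟨1, β⟩) (elt _ h) : ZIrr B) : P → ℂ) x = (β χ x : ℂ) := by
      intro χ h x
      rw [helt, PIauxPhi_apply]
      simp [hb]
    refine ⟨?_, ?_⟩
    · intro χ ψ ξ hχ hψ hξ hm x
      obtain ⟨χ, rfl⟩ := (PIaux_mem hB _).1 hχ
      obtain ⟨ψ, rfl⟩ := (PIaux_mem hB _).1 hψ
      obtain ⟨ξ, rfl⟩ := (PIaux_mem hB _).1 hξ
      have : ξ = χ * ψ := MonoidHom.ext fun g => Units.ext (by simpa using hm g)
      subst this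
      rw [hact, hact, hact, map_mul]
      simp
    · obtain ⟨α, hα⟩ := PIaux_dual β
      refine ⟨α, fun χ hχ g => ?_⟩
      obtain ⟨χ, rfl⟩ := (PIaux_mem hB _).1 hχ
      rw [hact, hα]
  · refine ⟨(PIauxPhi b).range, fun I => ⟨?_, fun h => PIaux_surj hP hB b hb I h⟩, ?_⟩
    · rintro ⟨x, rfl⟩
      exact PIauxPhi_perf hP hB b hb x
    · let f := (CommGroup.monoidHom_mulEquiv_of_hasEnoughRootsOfUnity P ℂ).some
      let c : ℤˣ ≃* Multiplicative (ZMod 2) :=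
        mulEquivOfPrimeCardEq (p := 2) (by simp) (by simp)
      let s : (PIauxD P ⋊[MonoidHom.id (MulAut (PIauxD P))] MulAut (PIauxD P)) ≃*
          (P ⋊[MonoidHom.id (MulAut P)] MulAut P) :=
        SemidirectProduct.congr f (MulAut.congr f) (fun g => by ext; simp)
      exact ⟨(MonoidHom.ofInjective (PIauxPhi_inj b hb)).symm.trans (MulEquiv.prodCongr c s)⟩

end
end
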